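/- arXiv:1503.08573 — 2 statements merged into one kernel-verified Lean document; each statement's English description precedes it below -/
import Mathlib

section
/- The complete generating function Q(x,y;t) of Gessel walks is algebraic over ℚ(x,y,t) of degree 72: there exists a nonzero polynomial P ∈ ℚ[x,y,t][z] of degree 72 in z with P(Q(x,y;t)) = 0 (the equation holding in the ring of formal power series in t with coefficients in ℚ[x,y]), and no nonzero polynomial in ℚ[x,y,t][z] of degree less than 72 in z annihilates Q(x,y;t). -/
/-- Number of Gessel walks of `n` steps starting at the origin, staying in the quadrant
`ℕ²`, and ending at `(i,j)`. Steps: `(1,0), (1,1), (-1,0), (-1,-1)`. -/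
def gesselCount : ℕ → ℕ → ℕ → ℕ
  | 0, i, j => if i = 0 ∧ j = 0 then 1 else 0
  | n+1, i, j =>
      (if 1 ≤ i then gesselCount n (i-1) j else 0) +
      (if 1 ≤ i ∧ 1 ≤ j then gesselCount n (i-1) (j-1) else 0) +
      gesselCount n (i+1) j + gesselCount n (i+1) (j+1)

open MvPolynomial

/-- The complete generating function `Q(x,y;t)` of Gessel walks, as a formal power
series in `t` with coefficients in `ℚ[x,y]` (with `x = X 0`, `y = X 1`). -/
noncomputable def Qfull : PowerSeries (MvPolynomial (Fin 2) ℚ) :=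
  PowerSeries.mk fun n => ∑ i ∈ Finset.range (n+1), ∑ j ∈ Finset.range (n+1),
    (gesselCount n i j : MvPolynomial (Fin 2) ℚ) * X 0 ^ i * X 1 ^ j

/-- The canonical map `ℚ[x,y][t] → ℚ[x,y][[t]]`. -/
noncomputable def toPS : Polynomial (MvPolynomial (Fin 2) ℚ) →+* PowerSeries (MvPolynomial (Fin 2) ℚ) :=
  Polynomial.coeToPowerSeries.ringHom

open Polynomial in
/-- The minimal polynomial of the reciprocal of the uniformizing parameter `η`. -/
noncomputable def octic {A : Type*} [CommRing A] (t : A) : A[X] :=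
  Polynomial.X ^ 8 - Polynomial.C (16 * t ^ 2 + 1) * Polynomial.X ^ 6 +
      Polynomial.C (18 * t ^ 2) * Polynomial.X ^ 4 - Polynomial.C (27 * t ^ 4)

theorem octic_map {A B : Type*} [CommRing A] [CommRing B] (f : A →+* B) (t : A) :
    (octic t).map f = octic (f t) := by
  simp [octic, map_ofNat f]

theorem octic_natDegree {A : Type*} [CommRing A] [Nontrivial A] (t : A) :
    (octic t).natDegree = 8 := by
  unfold octic
  compute_degree!

theorem octic_monic {A : Type*} [CommRing A] (t : A) : (octic t).Monic := by
  unfold octic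
  monicity!

theorem octic_eval₂ {A B : Type*} [CommRing A] [CommRing B] [Algebra A B] (t : A) (z : B) :
    Polynomial.aeval z (octic t) = z ^ 8 - (16 * algebraMap A B t ^ 2 + 1) * z ^ 6
      + 18 * algebraMap A B t ^ 2 * z ^ 4 - 27 * algebraMap A B t ^ 4 := by
  simp [octic, map_ofNat (algebraMap A B)]

theorem pow_eq_neg_one_of_octic_root {K : Type*} [Field K] [CharP K 5] {β : K}
    (h : β ^ 8 + 2 * β ^ 4 + 3 = 0) : β ^ 48 = -1 := by
  have h5 : (5 : K) = 0 := by exact_mod_cast CharP.cast_eq_zero K 5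
  obtain ⟨u, hu⟩ : ∃ u, β ^ 4 = u := ⟨_, rfl⟩
  have h2 : u ^ 2 = -2 * u - 3 := by rw [← hu]; linear_combination h
  have e : β ^ 48 = u ^ 12 := by rw [← hu]; ring
  rw [e]
  grind

theorem irreducible_octic_zmod_five : Irreducible (octic (2 : ZMod 5)) := by
  have : Fact (Nat.Prime 5) := ⟨by norm_num⟩
  have key : ∀ q : Polynomial (ZMod 5), Irreducible q → q ∣ octic (2 : ZMod 5) →
      8 ≤ q.natDegree := by
    intro q hq hdvd
    by_contra! hlt
    have : Fact (Irreducible q) := ⟨hq⟩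
    have : CharP (AdjoinRoot q) 5 := charP_of_injective_algebraMap (algebraMap (ZMod 5) _).injective 5
    have : Module.Finite (ZMod 5) (AdjoinRoot q) :=
      (AdjoinRoot.powerBasis hq.ne_zero).finite
    have : Finite (AdjoinRoot q) := Module.finite_of_finite (ZMod 5)
    let := Fintype.ofFinite (AdjoinRoot q)
    have hcard : Fintype.card (AdjoinRoot q) = 5 ^ q.natDegree := by
      rw [Module.card_eq_pow_finrank (K := ZMod 5), ZMod.card,
        (AdjoinRoot.powerBasis hq.ne_zero).finrank, AdjoinRoot.powerBasis_dim]
    have h5 : (5 : AdjoinRoot q) = 0 := by exact_mod_cast CharP.cast_eq_zero (AdjoinRoot q) 5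
    set β := AdjoinRoot.root q
    have hβ : β ^ 8 + 2 * β ^ 4 + 3 = 0 := by
      have h0 : Polynomial.aeval β (octic (2 : ZMod 5)) = 0 := by
        obtain ⟨r, hr⟩ := hdvd
        rw [hr, map_mul]
        simp [β, AdjoinRoot.aeval_eq]
      rw [octic_eval₂] at h0
      simp only [map_ofNat] at h0
      linear_combination h0 + (13 * β ^ 6 - 14 * β ^ 4 + 87) * h5
    have h48 := pow_eq_neg_one_of_octic_root hβ
    have hβ0 : β ≠ 0 := by
      intro h0
      simp [h0] at h48
    have hN := FiniteField.pow_card_sub_one_eq_one β hβ0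
    rw [hcard] at hN
    have h11 : (1 : AdjoinRoot q) ≠ -1 := by
      intro h
      have h2 : (2 : AdjoinRoot q) = 0 := by linear_combination h
      have : (1 : AdjoinRoot q) = 0 := by linear_combination h5 - 2 * h2
      exact one_ne_zero this
    have fin : ∀ m n : ℕ, Odd n → 48 * n = (5 ^ q.natDegree - 1) * m → False := by
      intro m n hn hmn
      apply h11
      calc (1 : AdjoinRoot q) = (β ^ (5 ^ q.natDegree - 1)) ^ m := by rw [hN, one_pow]
        _ = (β ^ 48) ^ n := by rw [← pow_mul, ← hmn, pow_mul]
        _ = -1 := by rw [h48, hn.neg_one_pow]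
    have hpos := hq.natDegree_pos
    generalize q.natDegree = d at *
    interval_cases d
    · exact fin 12 1 (by decide) (by norm_num)
    · exact fin 2 1 (by decide) (by norm_num)
    · exact fin 12 31 (by decide) (by norm_num)
    · exact fin 1 13 (by decide) (by norm_num)
    · exact fin 12 781 (by decide) (by norm_num)
    · exact fin 6 1953 (by decide) (by norm_num)
    · exact fin 12 19531 (by decide) (by norm_num)
  have h0 : octic (2 : ZMod 5) ≠ 0 := (octic_monic _).ne_zero
  have hnu : ¬ IsUnit (octic (2 : ZMod 5)) := by
    intro h
    have := Polynomial.natDegree_eq_zero_of_isUnit h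
    rw [octic_natDegree] at this
    omega
  obtain ⟨q, hq, r, hr⟩ := WfDvdMonoid.exists_irreducible_factor hnu h0
  have hq8 := key q hq ⟨r, hr⟩
  have hr0 : r ≠ 0 := by
    rintro rfl
    simp [h0] at hr
  have hdeg : q.natDegree + r.natDegree = 8 := by
    rw [← Polynomial.natDegree_mul hq.ne_zero hr0, ← hr, octic_natDegree]
  have hru : IsUnit r := by
    rw [Polynomial.isUnit_iff_degree_eq_zero, Polynomial.degree_eq_natDegree hr0]
    have : r.natDegree = 0 := by omega
    simp [this]
  rw [hr]
  exact (irreducible_mul_isUnit hru).mpr hq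

theorem irreducible_octic_rat : Irreducible (octic (2 : ℚ)) := by
  have : Fact (Nat.Prime 5) := ⟨by norm_num⟩
  have h := Polynomial.Monic.irreducible_of_irreducible_map (Int.castRingHom (ZMod 5))
    (octic (2 : ℤ)) (octic_monic _) (by
      rw [octic_map]; simpa using irreducible_octic_zmod_five)
  rw [(octic_monic _).irreducible_iff_irreducible_map_fraction_map (K := ℚ), octic_map] at h
  simpa using h

theorem irreducible_octic {R k : Type*} [CommRing R] [IsDomain R] [IsIntegrallyClosed R]
    [Field k] [Algebra R k] [IsFractionRing R k] (φ : R →+* ℚ) {t : R} (ht : φ t = 2) :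
    Irreducible (octic (algebraMap R k t)) := by
  have h := Polynomial.Monic.irreducible_of_irreducible_map φ (octic t) (octic_monic _) (by
      rw [octic_map, ht]; exact irreducible_octic_rat)
  rwa [(octic_monic _).irreducible_iff_irreducible_map_fraction_map (K := k), octic_map] at h

open Polynomial in
theorem cubic_form_ne {F : Type*} [Field F] {P R N D : F[X]} (hPR : IsCoprime P R)
    (hR : R.natDegree = 4) (hP : P.natDegree < 4) {a b c : F} (hc : c ≠ 0)
    (hND : IsCoprime N D) (hD : D ≠ 0) :
    P * (N ^ 3 - Polynomial.C a * N ^ 2 * D + Polynomial.C b * N * D ^ 2 + Polynomial.C c * D ^ 3) ≠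
        R * N * D ^ 2 := by
  intro h
  have hR0 : R ≠ 0 := by rintro rfl; simp at hR
  have hP0 : P ≠ 0 := by
    rintro rfl
    rw [isCoprime_zero_left] at hPR
    have := natDegree_eq_zero_of_isUnit hPR
    omega
  set E := Polynomial.C c * D ^ 3 + (Polynomial.C b * N * D ^ 2 -
      Polynomial.C a * N ^ 2 * D) with hE
  set H := N ^ 3 - Polynomial.C a * N ^ 2 * D + Polynomial.C b * N * D ^ 2 +
      Polynomial.C c * D ^ 3 with hH
  have hcu : IsUnit (Polynomial.C c) := by simpa using hc
  have hHN : IsCoprime H N := by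
    have h1 : IsCoprime (Polynomial.C c * D ^ 3) N :=
      (isCoprime_mul_unit_left_left hcu _ _).mpr hND.symm.pow_left
    have h2 : H = Polynomial.C c * D ^ 3 +
        N * (N ^ 2 - Polynomial.C a * N * D + Polynomial.C b * D ^ 2) := by rw [hH]; ring
    rw [h2]
    exact h1.add_mul_left_left _
  have hHD : IsCoprime H D := by
    have h1 : IsCoprime (N ^ 3) D := hND.pow_left
    have h2 : H = N ^ 3 + D * (- Polynomial.C a * N ^ 2 + Polynomial.C b * N * D +
        Polynomial.C c * D ^ 2) := by rw [hH]; ring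
    rw [h2]
    exact h1.add_mul_left_left _
  have hHR : H ∣ R := by
    have h1 : IsCoprime H (N * D ^ 2) := hHN.mul_right hHD.pow_right
    apply h1.dvd_of_dvd_mul_right
    exact ⟨P, by rw [← mul_assoc, ← h]; ring⟩
  have hRH : R ∣ H := by
    apply hPR.symm.dvd_of_dvd_mul_left
    exact ⟨N * D ^ 2, by rw [h]; ring⟩
  have hHdeg : H.natDegree = 4 := by
    rw [← hR]
    exact natDegree_eq_of_degree_eq (degree_eq_degree_of_associated (associated_of_dvd_dvd hHR hRH))
  have hH0 : H ≠ 0 := by intro h0; simp [h0] at hHdeg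
  have hN0 : N ≠ 0 := by
    rintro rfl
    simp [hP0, hH0] at h
  have hdeg : P.natDegree + 4 = 4 + N.natDegree + 2 * D.natDegree := by
    have := congrArg natDegree h
    rwa [natDegree_mul hP0 hH0, natDegree_mul (mul_ne_zero hR0 hN0) (pow_ne_zero _ hD),
      natDegree_mul hR0 hN0, natDegree_pow, hHdeg, hR] at this
  have hHE : H = N ^ 3 + E := by rw [hH, hE]; ring
  have hC : ∀ (r : F) (i j : ℕ),
      (Polynomial.C r * N ^ i * D ^ j).natDegree ≤ i * N.natDegree + j * D.natDegree := by
    intro r i j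
    refine (natDegree_mul_le).trans (add_le_add ?_ natDegree_pow_le)
    exact (natDegree_C_mul_le _ _).trans natDegree_pow_le
  have e1 := hC c 0 3
  have e2 := hC b 1 2
  have e3 := hC a 2 1
  simp only [pow_zero, mul_one, pow_one, zero_mul, zero_add] at e1 e2 e3
  have e4 : E.natDegree ≤ max (3 * D.natDegree) (max (1 * N.natDegree + 2 * D.natDegree)
      (2 * N.natDegree + 1 * D.natDegree)) := by
    refine (natDegree_add_le _ _).trans (max_le_max e1 ?_)
    refine (natDegree_sub_le _ _).trans (max_le_max (by simpa using e2) (by simpa using e3))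
  have e5 : (N ^ 3).natDegree = 3 * N.natDegree := natDegree_pow _ _
  by_cases hnd : D.natDegree < N.natDegree
  · have : H.natDegree = 3 * N.natDegree := by
      rw [hHE, natDegree_add_eq_left_of_natDegree_lt (by rw [e5]; omega), e5]
    omega
  · have := natDegree_add_le (N ^ 3) E
    rw [← hHE] at this
    omega

open Polynomial in
theorem cubic_no_root_adjoin {F Ω : Type*} [Field F] [Field Ω] [Algebra F Ω] {x : Ω}
    (hx : Transcendental F x) {P R : F[X]} (hPR : IsCoprime P R)
    (hR : R.natDegree = 4) (hP : P.natDegree < 4) {a b c : F} (hc : c ≠ 0) {ρ : Ω}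
    (hρ : ρ ∈ IntermediateField.adjoin F {x}) :
    Polynomial.aeval x P * (ρ ^ 3 - algebraMap F Ω a * ρ ^ 2 + algebraMap F Ω b * ρ +
        algebraMap F Ω c)
      ≠ Polynomial.aeval x R * ρ := by
  classical
  intro h
  have hinj := transcendental_iff_injective.mp hx
  have hP0 : P ≠ 0 := by
    rintro rfl
    rw [isCoprime_zero_left] at hPR
    have := natDegree_eq_zero_of_isUnit hPR
    omega
  obtain ⟨r, s, rfl⟩ := (IntermediateField.mem_adjoin_simple_iff F ρ).mp hρ
  have hs : s ≠ 0 := by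
    rintro rfl
    simp [hc] at h
    exact hP0 (hinj (by simpa using h))
  have hg : EuclideanDomain.gcd r s ≠ 0 := by
    intro h0
    exact hs (EuclideanDomain.gcd_eq_zero_iff.mp h0).2
  obtain ⟨N, hN⟩ := EuclideanDomain.gcd_dvd_left r s
  obtain ⟨D, hD⟩ := EuclideanDomain.gcd_dvd_right r s
  have hD0 : D ≠ 0 := by
    rintro rfl
    simp at hD
    exact hs hD
  have hcop : IsCoprime N D := by
    have h1 := EuclideanDomain.gcd_eq_gcd_ab r s
    refine ⟨EuclideanDomain.gcdA r s, EuclideanDomain.gcdB r s, ?_⟩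
    apply mul_left_cancel₀ hg
    linear_combination (-EuclideanDomain.gcdA r s) * hN - EuclideanDomain.gcdB r s * hD - h1
  refine cubic_form_ne hPR hR hP (a := a) (b := b) hc hcop hD0 (hinj ?_)
  have hgx : Polynomial.aeval x (EuclideanDomain.gcd r s) ≠ 0 := fun h0 =>
      hg (hinj (by simpa using h0))
  have hDx : Polynomial.aeval x D ≠ 0 := fun h0 => hD0 (hinj (by simpa using h0))
  have hfrac : Polynomial.aeval x r / Polynomial.aeval x s =
      Polynomial.aeval x N / Polynomial.aeval x D := by
    rw [← mul_div_mul_left (Polynomial.aeval x N) _ hgx, ← map_mul, ← map_mul, ← hN, ← hD]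
  rw [hfrac] at h
  simp only [map_mul, map_add, map_sub, map_pow, Polynomial.aeval_C]
  field_simp at h
  linear_combination h

theorem mem_range_of_aeval_eq_zero {F Ω : Type*} [Field F] [Field Ω] [Algebra F Ω]
    [IsAlgClosed F] {p : Polynomial F} (hp : p ≠ 0) {z : Ω} (hz : Polynomial.aeval z p = 0) :
    ∃ w : F, algebraMap F Ω w = z := by
  have hintegral : IsIntegral F z := isAlgebraic_iff_isIntegral.mp ⟨p, hp, hz⟩
  exact minpoly.mem_range_of_degree_eq_one F z
    (IsAlgClosed.degree_eq_one_of_irreducible F (minpoly.irreducible hintegral))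

open Polynomial in
theorem minpoly_cubic {K Ω : Type*} [Field K] [Field Ω] [Algebra K Ω] {A B C' : K} {l : Ω}
    (hl : l ^ 3 - algebraMap K Ω A * l ^ 2 + algebraMap K Ω B * l + algebraMap K Ω C' = 0)
    (hroot : ∀ r : K, r ^ 3 - A * r ^ 2 + B * r + C' ≠ 0) :
    minpoly K l = Polynomial.X ^ 3 - Polynomial.C A * Polynomial.X ^ 2 +
        Polynomial.C B * Polynomial.X + Polynomial.C C' := by
  have hm : (Polynomial.X ^ 3 - Polynomial.C A * Polynomial.X ^ 2 + Polynomial.C B * Polynomial.X +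
      Polynomial.C C').Monic := by monicity!
  have hd : (Polynomial.X ^ 3 - Polynomial.C A * Polynomial.X ^ 2 + Polynomial.C B * Polynomial.X +
      Polynomial.C C').natDegree = 3 := by compute_degree!
  refine (minpoly.eq_of_irreducible_of_monic ?_ (by simpa using hl) hm).symm
  refine irreducible_of_degree_le_three_of_not_isRoot (by simp [hd]) fun r hr => hroot r ?_
  simpa using hr

section cubic

open Polynomial

variable {F Ω : Type*} [Field F] [Field Ω] [Algebra F Ω] {x : Ω} (hx : Transcendental F x)
  {P R : F[X]} (hPR : IsCoprime P R) (hR : R.natDegree = 4) (hP : P.natDegree < 4)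

include hx hPR hR hP

theorem aeval_ne_zero_of_coprime : Polynomial.aeval x P ≠ 0 := by
  have hP0 : P ≠ 0 := by
    rintro rfl
    rw [isCoprime_zero_left] at hPR
    have := natDegree_eq_zero_of_isUnit hPR
    omega
  intro h
  exact hP0 (transcendental_iff_injective.mp hx (by simpa using h))

/-- The cubic `Z³ - a Z² + (b - I) Z + c`, with `I = R(x) / P(x)`, has no root in a field
of rational functions containing its coefficients. -/
theorem minpoly_cubic_of_transcendental {K : Type*} [Field K] [Algebra K Ω]
    (hK : ∀ z : K, algebraMap K Ω z ∈ IntermediateField.adjoin F {x})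
    {a b c : F} (hc : c ≠ 0) {A B C' : K} (hA : algebraMap K Ω A = algebraMap F Ω a)
    (hB : algebraMap K Ω B = algebraMap F Ω b - Polynomial.aeval x R / Polynomial.aeval x P)
    (hC : algebraMap K Ω C' = algebraMap F Ω c) {l : Ω}
    (hl : l ^ 3 - algebraMap F Ω a * l ^ 2 +
        (algebraMap F Ω b - Polynomial.aeval x R / Polynomial.aeval x P) * l
      + algebraMap F Ω c = 0) :
    minpoly K l = Polynomial.X ^ 3 - Polynomial.C A * Polynomial.X ^ 2 +
        Polynomial.C B * Polynomial.X + Polynomial.C C' := by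
  refine minpoly_cubic (by rw [hA, hB, hC]; exact hl) fun r hr => ?_
  have hPx := aeval_ne_zero_of_coprime hx hPR hR hP
  refine cubic_no_root_adjoin hx hPR hR hP (a := a) (b := b) hc (hK r) ?_
  have h := congrArg (algebraMap K Ω) hr
  simp only [map_add, map_sub, map_mul, map_pow, hA, hB, hC, map_zero] at h
  field_simp at h
  linear_combination h

theorem cubic_shift_unique {a b c a' b' c' δ : F} (hc : c ≠ 0) {l : Ω}
    (hl : l ^ 3 - algebraMap F Ω a * l ^ 2 +
        (algebraMap F Ω b - Polynomial.aeval x R / Polynomial.aeval x P) * l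
      + algebraMap F Ω c = 0)
    (hl' : (l - algebraMap F Ω δ) ^ 3 - algebraMap F Ω a' * (l - algebraMap F Ω δ) ^ 2
      + (algebraMap F Ω b' - Polynomial.aeval x R / Polynomial.aeval x P) * (l - algebraMap F Ω δ)
      + algebraMap F Ω c' = 0) :
    δ = 0 ∧ a = a' ∧ b = b' ∧ c = c' := by
  set M := IntermediateField.adjoin F {x}
  have hPx := aeval_ne_zero_of_coprime hx hPR hR hP
  have hxM : x ∈ M := IntermediateField.mem_adjoin_simple_self F x
  have hI : Polynomial.aeval x R / Polynomial.aeval x P ∈ M := by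
    apply div_mem
    · exact IntermediateField.algebra_adjoin_le_adjoin F _ (aeval_mem_adjoin_singleton F x)
    · exact IntermediateField.algebra_adjoin_le_adjoin F _ (aeval_mem_adjoin_singleton F x)
  obtain ⟨I, hI'⟩ : ∃ I : M, algebraMap M Ω I = Polynomial.aeval x R / Polynomial.aeval x P :=
      ⟨⟨_, hI⟩, rfl⟩
  have hFM : ∀ z : F, algebraMap M Ω (algebraMap F M z) = algebraMap F Ω z := fun z => rfl
  have hmin := minpoly_cubic_of_transcendental hx hPR hR hP (K := M) (fun z => z.2) hc
    (hFM a) (B := algebraMap F M b - I) (by rw [map_sub, hFM, hI']) (hFM c) hl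
  have hdeg : (minpoly M l).natDegree = 3 := by rw [hmin]; compute_degree!
  have indep : ∀ u₂ u₁ u₀ : M, algebraMap M Ω u₂ * l ^ 2 + algebraMap M Ω u₁ * l
      + algebraMap M Ω u₀ = 0 → u₂ = 0 ∧ u₁ = 0 ∧ u₀ = 0 := by
    intro u₂ u₁ u₀ h
    have hqz : Polynomial.C u₂ * Polynomial.X ^ 2 + Polynomial.C u₁ * Polynomial.X +
        Polynomial.C u₀ = 0 := by
      by_contra hne
      have h1 := minpoly.degree_le_of_ne_zero M l hne (by simpa using h)
      have h2 : (Polynomial.C u₂ * Polynomial.X ^ 2 + Polynomial.C u₁ * Polynomial.X +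
          Polynomial.C u₀).natDegree ≤ 2 := by compute_degree
      have h3 := natDegree_le_natDegree h1
      omega
    have hc2 := congrArg (fun p => Polynomial.coeff p 2) hqz
    have hc1 := congrArg (fun p => Polynomial.coeff p 1) hqz
    have hc0 := congrArg (fun p => Polynomial.coeff p 0) hqz
    simp [Polynomial.coeff_X, Polynomial.coeff_C] at hc2 hc1 hc0
    exact ⟨hc2, hc1, hc0⟩
  obtain ⟨hc2, hc1, hc0⟩ := indep (algebraMap F M (a - a' - 3 * δ))
    (algebraMap F M (b' - b + 3 * δ ^ 2 + 2 * a' * δ))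
    (algebraMap F M (c' - c - δ ^ 3 - a' * δ ^ 2 - b' * δ) + algebraMap F M δ * I) (by
      simp only [map_add, map_mul, hFM, hI']
      simp only [map_sub, map_mul, map_pow, map_ofNat]
      linear_combination hl' - hl)
  have hδ : δ = 0 := by
    by_contra hδ
    obtain ⟨i, hi⟩ : ∃ i : F, algebraMap F M i = I := by
      refine ⟨-(c' - c - δ ^ 3 - a' * δ ^ 2 - b' * δ) / δ, ?_⟩
      have h0 : algebraMap F M δ ≠ 0 := by simpa using hδ
      rw [map_div₀, div_eq_iff h0, map_neg]
      linear_combination -hc0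
    have h1 : Polynomial.aeval x (R - Polynomial.C i * P) = 0 := by
      rw [map_sub, map_mul, Polynomial.aeval_C, ← hFM, hi, hI']
      field_simp
      simp
    have h2 : R - Polynomial.C i * P = 0 := transcendental_iff_injective.mp hx (by simpa using h1)
    have h3 : (Polynomial.C i * P).natDegree < 4 := (natDegree_C_mul_le _ _).trans_lt hP
    rw [← sub_eq_zero.mp h2] at h3
    omega
  subst hδ
  have inj := fun z => (map_eq_zero (algebraMap F M) (a := z)).mp
  have h2 := inj _ hc2
  have h1 := inj _ hc1
  have h0 := inj _ (by simpa only [map_zero, zero_mul, add_zero] using hc0)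
  exact ⟨rfl, by linear_combination h2, by linear_combination -h1, by linear_combination -h0⟩

end cubic

theorem finrank_adjoin_insert {k Ω : Type*} [Field k] [Field Ω] [Algebra k Ω]
    (s : Set Ω) (l : Ω) :
    Module.finrank k (IntermediateField.adjoin k (s ∪ {l})) =
      Module.finrank k (IntermediateField.adjoin k s) *
      Module.finrank (IntermediateField.adjoin k s)
        (IntermediateField.adjoin (IntermediateField.adjoin k s) {l}) := by
  rw [← IntermediateField.adjoin_adjoin_left]
  exact (Module.finrank_mul_finrank k (IntermediateField.adjoin k s)
    (IntermediateField.adjoin (IntermediateField.adjoin k s) {l})).symm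

theorem kappa_unique {Ω : Type*} [Field Ω] [CharZero Ω] {t η η' : Ω} (ht : t ≠ 0) (hη : η ≠ 0)
    (hη' : η' ≠ 0)
    (ha : (1 + 3 * t ^ 2 * η ^ 4) / (t * η) = (1 + 3 * t ^ 2 * η' ^ 4) / (t * η'))
    (hb : 4 - η ^ 2 + 3 * t ^ 2 * η ^ 6 = 4 - η' ^ 2 + 3 * t ^ 2 * η' ^ 6)
    (hc : -η * (1 - t ^ 2 * η ^ 4) ^ 2 / t = -η' * (1 - t ^ 2 * η' ^ 4) ^ 2 / t) : η = η' := by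
  obtain ⟨κ, hκ⟩ : ∃ κ, κ = t ^ 2 * η ^ 4 := ⟨_, rfl⟩
  obtain ⟨κ', hκ'⟩ : ∃ κ', κ' = t ^ 2 * η' ^ 4 := ⟨_, rfl⟩
  have ha' : (1 + 3 * κ) * η' = (1 + 3 * κ') * η := by
    rw [div_eq_div_iff (mul_ne_zero ht hη) (mul_ne_zero ht hη')] at ha
    apply mul_left_cancel₀ ht
    rw [hκ, hκ']
    linear_combination ha
  have hb' : η ^ 2 * (3 * κ - 1) = η' ^ 2 * (3 * κ' - 1) := by
    rw [hκ, hκ']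
    linear_combination hb
  have hc' : η * (1 - κ) ^ 2 = η' * (1 - κ') ^ 2 := by
    rw [div_left_inj' ht] at hc
    rw [hκ, hκ']
    linear_combination -hc
  have h1 : (1 + 3 * κ) ^ 2 * (3 * κ - 1) = (1 + 3 * κ') ^ 2 * (3 * κ' - 1) := by
    apply mul_left_cancel₀ (pow_ne_zero 2 (mul_ne_zero hη hη'))
    linear_combination (3 * κ - 1) * η ^ 2 * ((1 + 3 * κ) * η' + (1 + 3 * κ') * η) * ha'
      + (1 + 3 * κ') ^ 2 * η ^ 2 * hb'
  have h2 : (1 + 3 * κ) * (1 - κ) ^ 2 = (1 + 3 * κ') * (1 - κ') ^ 2 := by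
    apply mul_left_cancel₀ (mul_ne_zero hη hη')
    linear_combination (1 - κ) ^ 2 * η * ha' + (1 + 3 * κ') * η * hc'
  have hκκ : κ = κ' := by
    by_contra hne
    have hd : κ - κ' ≠ 0 := sub_ne_zero.mpr hne
    have h3 : κ + κ' = 2 / 9 := by
      apply mul_left_cancel₀ hd
      linear_combination (9 * h2 - h1) / (-54)
    have h4 : κ * κ' = 1 / 81 := by
      apply mul_left_cancel₀ hd
      linear_combination -h1 / 27 + (κ - κ') * (κ + κ' + 2 / 9 + 1 / 3) * h3
    exact hd (pow_eq_zero_iff (two_ne_zero) |>.mp (by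
      linear_combination (κ + κ' + 2 / 9) * h3 - 4 * h4 : (κ - κ') ^ 2 = 0))
  subst hκκ
  have h3 : (1 + 3 * κ) * (η - η') = 0 := by linear_combination -ha'
  have h4 : (1 - κ) ^ 2 * (η - η') = 0 := by linear_combination hc'
  by_contra hne
  have hd := sub_ne_zero.mpr hne
  have h5 := (mul_eq_zero_iff_right hd).mp h3
  have h6 := pow_eq_zero_iff (two_ne_zero) |>.mp ((mul_eq_zero_iff_right hd).mp h4)
  have : (4 : Ω) = 0 := by linear_combination h5 + 3 * h6
  norm_num at this

/-- The rational invariant of the step set in the variable `x`. -/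
def invX {A : Type*} [Field A] (t x : A) : A :=
  (t * (x ^ 2 + 1) ^ 2 - x * (x ^ 2 + 1)) / (t * x ^ 2)

/-- The rational invariant of the step set in the variable `y`. -/
def invY {A : Type*} [Field A] (t y : A) : A :=
  (4 * t ^ 2 * y * (1 + y) ^ 2 - y ^ 2 - t ^ 2 * (1 + y) ^ 4) / (t ^ 2 * (y * (1 + y) ^ 2))

/-- The coefficients of the invariant cubic, in terms of the parameter `η`. -/
def coeffA {A : Type*} [Field A] (t η : A) : A := (1 + 3 * t ^ 2 * η ^ 4) / (t * η)

/-- See `coeffA`. -/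
def coeffB {A : Type*} [Field A] (t η : A) : A := 4 - η ^ 2 + 3 * t ^ 2 * η ^ 6

/-- See `coeffA`. -/
def coeffC {A : Type*} [Field A] (t η : A) : A := -η * (1 - t ^ 2 * η ^ 4) ^ 2 / t

/-- The invariant cubic, with invariant `I`, evaluated at `z`. -/
def invCubic {A : Type*} [Field A] (t η I z : A) : A :=
  z ^ 3 - coeffA t η * z ^ 2 + (coeffB t η - I) * z + coeffC t η

/-- The equation satisfied by the parameter `η`. -/
def etaRel {A : Type*} [Field A] (t η : A) : A :=
  27 * t ^ 4 * η ^ 8 - 18 * t ^ 2 * η ^ 4 + (16 * t ^ 2 + 1) * η ^ 2 - 1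

section map

variable {A B : Type*} [Field A] [Field B] (f : A →+* B) (t x η I z : A)

theorem map_invX : f (invX t x) = invX (f t) (f x) := by simp [invX]

theorem map_invY : f (invY t x) = invY (f t) (f x) := by simp [invY, map_ofNat f]

theorem map_coeffA : f (coeffA t η) = coeffA (f t) (f η) := by simp [coeffA, map_ofNat f]

theorem map_coeffB : f (coeffB t η) = coeffB (f t) (f η) := by simp [coeffB, map_ofNat f]

theorem map_coeffC : f (coeffC t η) = coeffC (f t) (f η) := by simp [coeffC]

theorem map_invCubic : f (invCubic t η I z) = invCubic (f t) (f η) (f I) (f z) := by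
  simp [invCubic, map_coeffA, map_coeffB, map_coeffC]

theorem map_etaRel : f (etaRel t η) = etaRel (f t) (f η) := by simp [etaRel, map_ofNat f]

end map

theorem eta_ne_zero {A : Type*} [Field A] {t η : A} (h : etaRel t η = 0) : η ≠ 0 := by
  rintro rfl
  simp [etaRel] at h

theorem isCoprime_right_of_isUnit {A : Type*} [CommRing A] {u z : A} (hu : IsUnit u) :
    IsCoprime z u := by
  simpa using (isCoprime_mul_unit_left_right hu z 1).mpr isCoprime_one_right

section polynomials

open Polynomial

variable {F : Type*} [Field F] {t : F} (ht : t ≠ 0)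

include ht

theorem isCoprime_invX :
    IsCoprime (Polynomial.C t * Polynomial.X ^ 2)
        (Polynomial.C t * (Polynomial.X ^ 2 + 1) ^ 2 - Polynomial.X * (Polynomial.X ^ 2 + 1)) := by
  have hu : IsUnit (Polynomial.C t) := by simpa using ht
  refine (isCoprime_mul_unit_left_left hu _ _).mpr (IsCoprime.pow_left ?_)
  have h : (Polynomial.C t * (Polynomial.X ^ 2 + 1) ^ 2 - Polynomial.X * (Polynomial.X ^ 2 + 1) :
      F[X])
      = Polynomial.C t + Polynomial.X * (Polynomial.C t * (Polynomial.X ^ 3 + 2 * Polynomial.X) -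
          Polynomial.X ^ 2 - 1) := by ring
  rw [h]
  exact (isCoprime_right_of_isUnit hu).add_mul_left_right _

theorem natDegree_invX : (Polynomial.C t * (Polynomial.X ^ 2 + 1) ^ 2 -
    Polynomial.X * (Polynomial.X ^ 2 + 1)).natDegree = 4 := by
  compute_degree!

theorem isCoprime_invY :
    IsCoprime (Polynomial.C (t ^ 2) * (Polynomial.X * (1 + Polynomial.X) ^ 2))
      (4 * Polynomial.C (t ^ 2) * Polynomial.X * (1 + Polynomial.X) ^ 2 - Polynomial.X ^ 2 -
          Polynomial.C (t ^ 2) * (1 + Polynomial.X) ^ 4) := by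
  have hu : IsUnit (Polynomial.C (t ^ 2)) := by simpa using ht
  refine (isCoprime_mul_unit_left_left hu _ _).mpr (IsCoprime.mul_left ?_ (IsCoprime.pow_left ?_))
  · have h : (4 * Polynomial.C (t ^ 2) * Polynomial.X * (1 + Polynomial.X) ^ 2 - Polynomial.X ^ 2 -
      Polynomial.C (t ^ 2) * (1 + Polynomial.X) ^ 4 : F[X])
        = -Polynomial.C (t ^ 2) + Polynomial.X *
            (4 * Polynomial.C (t ^ 2) * (1 + Polynomial.X) ^ 2 - Polynomial.X
          - Polynomial.C (t ^ 2) * (4 + 6 * Polynomial.X + 4 * Polynomial.X ^ 2 +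
              Polynomial.X ^ 3)) := by ring
    rw [h]
    exact (isCoprime_right_of_isUnit hu.neg).add_mul_left_right _
  · have h : (4 * Polynomial.C (t ^ 2) * Polynomial.X * (1 + Polynomial.X) ^ 2 - Polynomial.X ^ 2 -
      Polynomial.C (t ^ 2) * (1 + Polynomial.X) ^ 4 : F[X])
        = -1 + (1 + Polynomial.X) * (4 * Polynomial.C (t ^ 2) * Polynomial.X * (1 + Polynomial.X) +
            1 - Polynomial.X - Polynomial.C (t ^ 2) * (1 + Polynomial.X) ^ 3) := by
      ring
    rw [h]
    exact (isCoprime_right_of_isUnit isUnit_one.neg).add_mul_left_right _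

theorem natDegree_invY :
    (4 * Polynomial.C (t ^ 2) * Polynomial.X * (1 + Polynomial.X) ^ 2 - Polynomial.X ^ 2 -
        Polynomial.C (t ^ 2) * (1 + Polynomial.X) ^ 4).natDegree = 4 := by
  compute_degree!

omit ht in
theorem natDegree_invX_denom_lt : (Polynomial.C t * Polynomial.X ^ 2).natDegree < 4 := by
  refine lt_of_le_of_lt (b := 2) ?_ (by norm_num)
  compute_degree

omit ht in
theorem natDegree_invY_denom_lt : (Polynomial.C (t ^ 2) *
    (Polynomial.X * (1 + Polynomial.X) ^ 2)).natDegree < 4 := by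
  refine lt_of_le_of_lt (b := 3) ?_ (by norm_num)
  compute_degree

end polynomials

section eta

variable {k Ω : Type*} [Field k] [Field Ω] [Algebra k Ω] {t : k}
  (hoct : Irreducible (octic t)) {η : Ω} (hη : etaRel (algebraMap k Ω t) η = 0)

include hoct hη

theorem minpoly_inv_eta : minpoly k η⁻¹ = octic t := by
  have hη0 := eta_ne_zero hη
  have h0 : Polynomial.aeval η⁻¹ (octic t) = 0 := by
    rw [octic_eval₂]
    unfold etaRel at hη
    field_simp
    linear_combination -hη
  exact (minpoly.eq_of_irreducible_of_monic hoct h0 (octic_monic t)).symm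

theorem finrank_adjoin_eta : Module.finrank k (IntermediateField.adjoin k {η}) = 8 := by
  have hmin := minpoly_inv_eta hoct hη
  have hintegral : IsIntegral k η⁻¹ := by
    by_contra h
    rw [minpoly.eq_zero h] at hmin
    exact (octic_monic t).ne_zero hmin.symm
  have heq : IntermediateField.adjoin k {η} = IntermediateField.adjoin k {η⁻¹} := by
    apply le_antisymm <;> rw [IntermediateField.adjoin_simple_le_iff]
    · simpa using inv_mem (IntermediateField.mem_adjoin_simple_self k η⁻¹)
    · exact inv_mem (IntermediateField.mem_adjoin_simple_self k η)
  rw [heq, IntermediateField.adjoin.finrank hintegral, hmin, octic_natDegree]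

theorem coeffC_ne_zero : coeffC (algebraMap k Ω t) η ≠ 0 := by
  have hη0 := eta_ne_zero hη
  have ht : t ≠ 0 := by
    rintro rfl
    have h : (octic (0 : k)) = Polynomial.X ^ 6 * (Polynomial.X ^ 2 - 1) := by
      simp [octic]
      ring
    rw [h] at hoct
    rcases hoct.isUnit_or_isUnit rfl with h | h
    · have := Polynomial.natDegree_eq_zero_of_isUnit h
      simp at this
    · have h1 := Polynomial.natDegree_eq_zero_of_isUnit h
      have h2 : (Polynomial.X ^ 2 - 1 : Polynomial k).natDegree = 2 := by compute_degree!
      omega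
  have htΩ : algebraMap k Ω t ≠ 0 := by simpa using ht
  have h1 : 1 - algebraMap k Ω t ^ 2 * η ^ 4 ≠ 0 := by
    intro h
    have hm : (Polynomial.X ^ 4 - Polynomial.C (t ^ 2)).Monic := by monicity!
    have hd := minpoly.min k η⁻¹ hm (by
      simp only [map_sub, map_pow, Polynomial.aeval_X, Polynomial.aeval_C]
      field_simp
      linear_combination h)
    have h4 : (Polynomial.X ^ 4 - Polynomial.C (t ^ 2)).natDegree = 4 := by compute_degree!
    have := Polynomial.natDegree_le_natDegree hd
    rw [minpoly_inv_eta hoct hη, octic_natDegree, h4] at this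
    omega
  simp [coeffC, htΩ, hη0, h1]

end eta

theorem finrank_adjoin_insert_cubic {k Ω : Type*} [Field k] [Field Ω] [Algebra k Ω]
    (s : Set Ω) {l : Ω} {A B C' : IntermediateField.adjoin k s}
    (hmin : minpoly (IntermediateField.adjoin k s) l = Polynomial.X ^ 3
      - Polynomial.C A * Polynomial.X ^ 2 + Polynomial.C B * Polynomial.X + Polynomial.C C') :
    Module.finrank k (IntermediateField.adjoin k (s ∪ {l})) =
      Module.finrank k (IntermediateField.adjoin k s) * 3 := by
  have hdeg : (minpoly (IntermediateField.adjoin k s) l).natDegree = 3 := by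
    rw [hmin]
    compute_degree!
  have hintegral : IsIntegral (IntermediateField.adjoin k s) l := by
    by_contra h
    simp [minpoly.eq_zero h] at hdeg
  rw [finrank_adjoin_insert, IntermediateField.adjoin.finrank hintegral, hdeg]

open Polynomial in
theorem eta_mem_range {F Ω : Type*} [Field F] [Field Ω] [Algebra F Ω] [IsAlgClosed F] (t : F)
    {η : Ω} (hη : etaRel (algebraMap F Ω t) η = 0) : ∃ e : F, algebraMap F Ω e = η := by
  refine mem_range_of_aeval_eq_zero (p :=
      Polynomial.C (27 * t ^ 4) * Polynomial.X ^ 8 - Polynomial.C (18 * t ^ 2) * Polynomial.X ^ 4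
    + Polynomial.C (16 * t ^ 2 + 1) * Polynomial.X ^ 2 - 1) ?_ ?_
  · intro h
    have := congrArg (Polynomial.eval 0) h
    simp at this
  · unfold etaRel at hη
    simp only [map_add, map_sub, map_mul, map_pow, Polynomial.aeval_X, Polynomial.aeval_C,
        map_ofNat, map_one]
    linear_combination hη

open Polynomial in
theorem invCubic_mem_range {F Ω : Type*} [Field F] [Field Ω] [Algebra F Ω] [IsAlgClosed F]
    (t e i : F) {z : Ω}
    (hz : invCubic (algebraMap F Ω t) (algebraMap F Ω e) (algebraMap F Ω i) z = 0) :
    ∃ w : F, algebraMap F Ω w = z := by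
  refine mem_range_of_aeval_eq_zero (p :=
      Polynomial.X ^ 3 - Polynomial.C (coeffA t e) * Polynomial.X ^ 2
    + Polynomial.C (coeffB t e - i) * Polynomial.X + Polynomial.C (coeffC t e)) ?_ ?_
  · apply Monic.ne_zero
    monicity!
  · simp only [map_add, map_sub, map_mul, map_pow, Polynomial.aeval_X, Polynomial.aeval_C,
      map_coeffA, map_coeffB,
      map_coeffC]
    exact hz

open Polynomial in
theorem finrank_adjoin_invCubic {k F Ω : Type*} [Field k] [Field F] [Field Ω] [Algebra k Ω]
    [Algebra F Ω] {x : Ω} (hx : Transcendental F x) {P R : F[X]} (hPR : IsCoprime P R)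
    (hR : R.natDegree = 4) (hP : P.natDegree < 4)
    (hk : ∀ z : k, algebraMap k Ω z ∈ IntermediateField.adjoin F {x})
    {s : Set Ω} (hs : ∀ z ∈ s, z ∈ IntermediateField.adjoin F {x}) {t : k} {η I l : Ω}
    (hη : η ∈ IntermediateField.adjoin k s) (hI : I ∈ IntermediateField.adjoin k s)
    (hI' : I = Polynomial.aeval x R / Polynomial.aeval x P) {t₁ e : F}
        (ht : algebraMap F Ω t₁ = algebraMap k Ω t)
    (he : algebraMap F Ω e = η) (hc : coeffC (algebraMap k Ω t) η ≠ 0)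
    (hl : invCubic (algebraMap k Ω t) η I l = 0) :
    Module.finrank k (IntermediateField.adjoin k (s ∪ {l})) =
      Module.finrank k (IntermediateField.adjoin k s) * 3 := by
  set K := IntermediateField.adjoin k s
  obtain ⟨η, rfl⟩ : ∃ η' : K, algebraMap K Ω η' = η := ⟨⟨η, hη⟩, rfl⟩
  obtain ⟨I, rfl⟩ : ∃ I' : K, algebraMap K Ω I' = I := ⟨⟨I, hI⟩, rfl⟩
  have hK : ∀ z : K, algebraMap K Ω z ∈ IntermediateField.adjoin F {x} := by
    have h : K.toSubfield ≤ (IntermediateField.adjoin F {x}).toSubfield :=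
      IntermediateField.adjoin_le_subfield k _ (by rintro _ ⟨z, rfl⟩; exact hk z) hs
    exact fun z => h z.2
  have hkK : algebraMap k Ω t = algebraMap K Ω (algebraMap k K t) := rfl
  refine finrank_adjoin_insert_cubic s (minpoly_cubic_of_transcendental hx hPR hR hP hK
    (a := coeffA t₁ e) (b := coeffB t₁ e) (c := coeffC t₁ e) (A := coeffA (algebraMap k K t) η)
    (B := coeffB (algebraMap k K t) η - I) (C' := coeffC (algebraMap k K t) η) ?_ ?_ ?_ ?_ ?_)
  · intro h
    have h1 := congrArg (algebraMap F Ω) h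
    rw [map_coeffC, ht, he, map_zero] at h1
    exact hc h1
  · rw [map_coeffA, map_coeffA, ht, he, hkK]
  · rw [map_sub, map_coeffB, map_coeffB, ht, he, hkK, hI']
  · rw [map_coeffC, map_coeffC, ht, he, hkK]
  · rw [map_coeffA, map_coeffB, map_coeffC, ht, he, ← hI']
    exact hl

theorem ne_zero_of_algebraMap_eq {k F Ω : Type*} [Field k] [Field F] [Field Ω] [Algebra k Ω]
    [Algebra F Ω] {t : k} {t₁ : F} (ht₁ : algebraMap F Ω t₁ = algebraMap k Ω t) (ht : t ≠ 0) :
    t₁ ≠ 0 := by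
  rintro rfl
  rw [map_zero] at ht₁
  exact ht ((map_eq_zero _).mp ht₁.symm)

open Polynomial in
theorem invX_eq_aeval {F Ω : Type*} [Field F] [Field Ω] [Algebra F Ω] (t : F) (z : Ω) :
    invX (algebraMap F Ω t) z =
      Polynomial.aeval z (Polynomial.C t * (Polynomial.X ^ 2 + 1) ^ 2 -
          Polynomial.X * (Polynomial.X ^ 2 + 1)) /
          Polynomial.aeval z (Polynomial.C t * Polynomial.X ^ 2) := by
  simp [invX]

open Polynomial in
theorem invY_eq_aeval {F Ω : Type*} [Field F] [Field Ω] [Algebra F Ω] (t : F) (z : Ω) :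
    invY (algebraMap F Ω t) z =
      Polynomial.aeval z (4 * Polynomial.C (t ^ 2) * Polynomial.X * (1 + Polynomial.X) ^ 2 -
          Polynomial.X ^ 2 - Polynomial.C (t ^ 2) * (1 + Polynomial.X) ^ 4) /
        Polynomial.aeval z (Polynomial.C (t ^ 2) * (Polynomial.X * (1 + Polynomial.X) ^ 2)) := by
  simp [invY, map_ofNat]

section main

open Polynomial

variable {k Ω F₁ F₂ : Type*} [Field k] [Field Ω] [Algebra k Ω]
  [Field F₁] [IsAlgClosed F₁] [Algebra F₁ Ω] [Field F₂] [IsAlgClosed F₂] [Algebra F₂ Ω]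
  {x y t : k} (hx : Transcendental F₁ (algebraMap k Ω x))
  (hy : Transcendental F₂ (algebraMap k Ω y))
  (hk₁ : ∀ z : k, algebraMap k Ω z ∈ IntermediateField.adjoin F₁ {algebraMap k Ω x})
  (hk₂ : ∀ z : k, algebraMap k Ω z ∈ IntermediateField.adjoin F₂ {algebraMap k Ω y})
  {t₁ y₁ : F₁} (ht₁ : algebraMap F₁ Ω t₁ = algebraMap k Ω t)
  (hy₁ : algebraMap F₁ Ω y₁ = algebraMap k Ω y)
  {t₂ x₂ : F₂} (ht₂ : algebraMap F₂ Ω t₂ = algebraMap k Ω t)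
  (hx₂ : algebraMap F₂ Ω x₂ = algebraMap k Ω x)
  (ht : t ≠ 0) (hoct : Irreducible (octic t)) {η l α : Ω}
  (hη : etaRel (algebraMap k Ω t) η = 0)
  (hl : invCubic (algebraMap k Ω t) η (invX (algebraMap k Ω t) (algebraMap k Ω x)) l = 0)
  (hα : invCubic (algebraMap k Ω t) η (invY (algebraMap k Ω t) (algebraMap k Ω y)) α = 0)

include hx hy hk₁ hk₂ ht₁ ht₂ hx₂ ht hoct hη hl hα in
theorem finrank_adjoin_triple :
    Module.finrank k (IntermediateField.adjoin k (({η} ∪ {l}) ∪ {α})) = 72 := by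
  have hc := coeffC_ne_zero hoct hη
  have ht₁0 := ne_zero_of_algebraMap_eq ht₁ ht
  have ht₂0 := ne_zero_of_algebraMap_eq ht₂ ht
  obtain ⟨e₁, he₁⟩ := eta_mem_range t₁ (ht₁ ▸ hη)
  obtain ⟨e₂, he₂⟩ := eta_mem_range t₂ (ht₂ ▸ hη)
  obtain ⟨l₂, hl₂⟩ := invCubic_mem_range t₂ e₂ (invX t₂ x₂) (z := l)
    (by rw [map_invX, ht₂, hx₂, he₂]; exact hl)
  have hmem : ∀ (s : Set Ω) (z : k), algebraMap k Ω z ∈ IntermediateField.adjoin k s :=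
    fun s z => (IntermediateField.adjoin k s).algebraMap_mem z
  rw [finrank_adjoin_invCubic hy (isCoprime_invY ht₂0) (natDegree_invY ht₂0)
      natDegree_invY_denom_lt hk₂ ?_ ?_ ?_ ?_ ht₂ he₂ hc hα,
    finrank_adjoin_invCubic hx (isCoprime_invX ht₁0) (natDegree_invX ht₁0)
      natDegree_invX_denom_lt hk₁ ?_ ?_ ?_ ?_ ht₁ he₁ hc hl, finrank_adjoin_eta hoct hη]
  · rintro z rfl
    rw [← he₁]
    exact (IntermediateField.adjoin F₁ _).algebraMap_mem _
  · exact IntermediateField.mem_adjoin_simple_self k η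
  · rw [← map_invX]
    exact hmem _ _
  · rw [← ht₁, invX_eq_aeval]
  · rintro z (rfl | rfl)
    · rw [← he₂]
      exact (IntermediateField.adjoin F₂ _).algebraMap_mem _
    · rw [← hl₂]
      exact (IntermediateField.adjoin F₂ _).algebraMap_mem _
  · exact IntermediateField.subset_adjoin k _ (by simp)
  · rw [← map_invY]
    exact hmem _ _
  · rw [← ht₂, invY_eq_aeval]

variable [CharZero k]

include hx ht₁ hy₁ ht hoct in
theorem conj_unique {η' l' α' : Ω} (hη : etaRel (algebraMap k Ω t) η = 0)
    (hl : invCubic (algebraMap k Ω t) η (invX (algebraMap k Ω t) (algebraMap k Ω x)) l = 0)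
    (hα : invCubic (algebraMap k Ω t) η (invY (algebraMap k Ω t) (algebraMap k Ω y)) α = 0)
    (hη' : etaRel (algebraMap k Ω t) η' = 0)
    (hl' : invCubic (algebraMap k Ω t) η' (invX (algebraMap k Ω t) (algebraMap k Ω x)) l' = 0)
    (hα' : invCubic (algebraMap k Ω t) η' (invY (algebraMap k Ω t) (algebraMap k Ω y)) α' = 0)
    (h : α - l = α' - l') : η = η' ∧ l = l' ∧ α = α' := by
  have : CharZero Ω := charZero_of_injective_algebraMap (algebraMap k Ω).injective
  have ht₁0 := ne_zero_of_algebraMap_eq ht₁ ht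
  have htΩ : algebraMap k Ω t ≠ 0 := by simpa using ht
  have hc := coeffC_ne_zero hoct hη
  obtain ⟨e, he⟩ := eta_mem_range t₁ (ht₁ ▸ hη)
  obtain ⟨e', he'⟩ := eta_mem_range t₁ (ht₁ ▸ hη')
  obtain ⟨a, ha⟩ := invCubic_mem_range t₁ e (invY t₁ y₁) (z := α)
    (by rw [map_invY, ht₁, hy₁, he]; exact hα)
  obtain ⟨a', ha'⟩ := invCubic_mem_range t₁ e' (invY t₁ y₁) (z := α')
    (by rw [map_invY, ht₁, hy₁, he']; exact hα')
  have hl'' : l' = l - algebraMap F₁ Ω (a - a') := by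
    rw [map_sub, ha, ha']
    linear_combination h
  obtain ⟨h1, h2, h3, h4⟩ := cubic_shift_unique hx (isCoprime_invX ht₁0) (natDegree_invX ht₁0)
    natDegree_invX_denom_lt (a := coeffA t₁ e) (b := coeffB t₁ e) (c := coeffC t₁ e)
    (a' := coeffA t₁ e') (b' := coeffB t₁ e') (c' := coeffC t₁ e') (δ := a - a') (l := l)
    (by
      intro h0
      apply hc
      rw [← ht₁, ← he, ← map_coeffC, h0, map_zero])
    (by
      rw [← invX_eq_aeval, map_coeffA, map_coeffB, map_coeffC, ht₁, he]
      exact hl)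
    (by
      rw [← hl'', ← invX_eq_aeval, map_coeffA, map_coeffB, map_coeffC, ht₁, he']
      exact hl')
  have hαα : α = α' := by
    rw [← ha, ← ha', sub_eq_zero.mp h1]
  refine ⟨kappa_unique htΩ (eta_ne_zero hη) (eta_ne_zero hη') ?_ ?_ ?_, ?_, hαα⟩
  · have := congrArg (algebraMap F₁ Ω) h2
    rwa [map_coeffA, map_coeffA, ht₁, he, he'] at this
  · have := congrArg (algebraMap F₁ Ω) h3
    rwa [map_coeffB, map_coeffB, ht₁, he, he'] at this
  · have := congrArg (algebraMap F₁ Ω) h4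
    rwa [map_coeffC, map_coeffC, ht₁, he, he'] at this
  · linear_combination hαα - h

variable [IsAlgClosed Ω]

include hx hy hk₁ hk₂ ht₁ hy₁ ht₂ hx₂ ht hoct hη hl hα in
/-- The difference of the two roots generates an extension of degree `72`. -/
theorem finrank_adjoin_sub :
    Module.finrank k (IntermediateField.adjoin k {α - l}) = 72 := by
  set E := IntermediateField.adjoin k (({η} ∪ {l}) ∪ {α}) with hE
  have hfin := finrank_adjoin_triple hx hy hk₁ hk₂ ht₁ ht₂ hx₂ ht hoct hη hl hα
  rw [← hE] at hfin
  have : FiniteDimensional k E := FiniteDimensional.of_finrank_pos (by omega)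
  obtain ⟨ηE, hηE⟩ : ∃ z : E, algebraMap E Ω z = η :=
    ⟨⟨η, IntermediateField.subset_adjoin k _ (by simp)⟩, rfl⟩
  obtain ⟨lE, hlE⟩ : ∃ z : E, algebraMap E Ω z = l :=
    ⟨⟨l, IntermediateField.subset_adjoin k _ (by simp)⟩, rfl⟩
  obtain ⟨αE, hαE⟩ : ∃ z : E, algebraMap E Ω z = α :=
    ⟨⟨α, IntermediateField.subset_adjoin k _ (by simp)⟩, rfl⟩
  have hkE : ∀ z : k, algebraMap k Ω z = algebraMap E Ω (algebraMap k E z) := fun z => rfl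
  have inj := fun z => (map_eq_zero (algebraMap E Ω) (a := z)).mp
  have h1 : etaRel (algebraMap k E t) ηE = 0 := inj _ (by rw [map_etaRel, hηE, ← hkE]; exact hη)
  have h2 : invCubic (algebraMap k E t) ηE (invX (algebraMap k E t) (algebraMap k E x)) lE = 0 :=
    inj _ (by rw [map_invCubic, map_invX, hηE, hlE, ← hkE, ← hkE]; exact hl)
  have h3 : invCubic (algebraMap k E t) ηE (invY (algebraMap k E t) (algebraMap k E y)) αE = 0 :=
    inj _ (by rw [map_invCubic, map_invY, hηE, hαE, ← hkE, ← hkE]; exact hα)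
  have hprim : IntermediateField.adjoin k {αE - lE} = ⊤ := by
    rw [Field.primitive_element_iff_algHom_eq_of_eval k Ω (fun z => IsAlgClosed.splits _) _ E.val]
    intro ψ hψ
    have hψk : ∀ z : k, (ψ : E →+* Ω) (algebraMap k E z) = algebraMap k Ω z := ψ.commutes
    have h1' := congrArg (ψ : E →+* Ω) h1
    have h2' := congrArg (ψ : E →+* Ω) h2
    have h3' := congrArg (ψ : E →+* Ω) h3
    rw [map_etaRel, hψk, map_zero] at h1'
    rw [map_invCubic, map_invX, hψk, hψk, map_zero] at h2'
    rw [map_invCubic, map_invY, hψk, hψk, map_zero] at h3'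
    obtain ⟨g1, g2, g3⟩ := conj_unique hx ht₁ hy₁ ht hoct hη hl hα h1' h2' h3' (by
      have : algebraMap E Ω (αE - lE) = ψ (αE - lE) := hψ
      rw [map_sub, hαE, hlE, map_sub] at this
      exact this)
    refine IntermediateField.algHom_ext_of_eq_adjoin k hE ?_
    have key : ∀ z : E, algebraMap E Ω z = ψ z → ∀ w hw, w = algebraMap E Ω z →
        E.val ⟨w, hw⟩ = ψ ⟨w, hw⟩ := by
      rintro z hz w hw rfl
      exact hz
    rintro w ((rfl | rfl) | rfl)
    · exact key ηE (by rw [hηE]; exact g1) _ _ hηE.symm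
    · exact key lE (by rw [hlE]; exact g2) _ _ hlE.symm
    · exact key αE (by rw [hαE]; exact g3) _ _ hαE.symm
  have hmin : minpoly k (α - l) = minpoly k (αE - lE) := by
    rw [← minpoly.algebraMap_eq (algebraMap E Ω).injective (αE - lE), map_sub, hαE, hlE]
  have hintegral : IsIntegral k (αE - lE) := Algebra.IsIntegral.isIntegral _
  have hintegral' : IsIntegral k (α - l) := by
    have := hintegral.algebraMap (B := Ω)
    rwa [map_sub, hαE, hlE] at this
  rw [IntermediateField.adjoin.finrank hintegral', hmin, ← hfin]
  exact (Field.primitive_element_iff_minpoly_natDegree_eq k (αE - lE)).mp hprim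

end main

theorem isAlgClosed_algebraicClosure (K Ω : Type*) [Field K] [Field Ω] [Algebra K Ω]
    [IsAlgClosed Ω] : IsAlgClosed (algebraicClosure K Ω) :=
  (algebraicClosure.isAlgClosure K Ω).isAlgClosed

open scoped IntermediateField.algebraAdjoinAdjoin in
theorem exists_isAlgClosed_transcendental {Ω : Type*} [Field Ω] [Algebra ℚ Ω] [IsAlgClosed Ω]
    {S : Set Ω} {z : Ω} (hz : Transcendental (Algebra.adjoin ℚ S) z) :
    ∃ F : IntermediateField ℚ Ω, IsAlgClosed F ∧ Transcendental F z ∧ S ⊆ F := by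
  have h1 : Transcendental (IntermediateField.adjoin ℚ S) z := by
    rw [Transcendental, ← IsFractionRing.isAlgebraic_iff (Algebra.adjoin ℚ S)]
    exact hz
  refine ⟨(algebraicClosure (IntermediateField.adjoin ℚ S) Ω).restrictScalars ℚ, ?_, ?_, ?_⟩
  · exact isAlgClosed_algebraicClosure (IntermediateField.adjoin ℚ S) Ω
  · exact h1.algebraicClosure
  · intro s hs
    exact (algebraicClosure (IntermediateField.adjoin ℚ S) Ω).algebraMap_mem
      ⟨s, IntermediateField.subset_adjoin ℚ S hs⟩

theorem range_le_subfield {Ω : Type*} [Field Ω] (g : Polynomial (MvPolynomial (Fin 2) ℚ) →+* Ω)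
    (K : Subfield Ω) (hx : g (Polynomial.C (X 0)) ∈ K) (hy : g (Polynomial.C (X 1)) ∈ K)
    (ht : g Polynomial.X ∈ K) (r : Polynomial (MvPolynomial (Fin 2) ℚ)) : g r ∈ K := by
  have hC : ∀ p : MvPolynomial (Fin 2) ℚ, g (Polynomial.C p) ∈ K := by
    intro p
    induction p using MvPolynomial.induction_on with
    | C q =>
      have : g (Polynomial.C (C q)) = (q : Ω) :=
        eq_ratCast ((g.comp Polynomial.C).comp (C (σ := Fin 2))) q
      rw [this]
      exact SubfieldClass.ratCast_mem K q
    | add p q hp hq =>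
      rw [map_add, map_add]
      exact add_mem hp hq
    | mul_X p i hp =>
      rw [map_mul, map_mul]
      refine mul_mem hp ?_
      fin_cases i
      exacts [hx, hy]
  induction r using Polynomial.induction_on' with
  | add p q hp hq =>
    rw [map_add]
    exact add_mem hp hq
  | monomial n a =>
    rw [← Polynomial.C_mul_X_pow_eq_monomial, map_mul, map_pow]
    exact mul_mem (hC a) (pow_mem ht n)

theorem algebraMap_mem_of_isFractionRing {R k Ω : Type*} [CommRing R] [IsDomain R] [Field k]
    [Field Ω] [Algebra R k] [IsFractionRing R k] [Algebra k Ω] (K : Subfield Ω)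
    (h : ∀ r : R, algebraMap k Ω (algebraMap R k r) ∈ K) (z : k) : algebraMap k Ω z ∈ K := by
  obtain ⟨a, b, -, rfl⟩ := IsFractionRing.div_surjective (A := R) z
  rw [map_div₀]
  exact div_mem (h a) (h b)

theorem finrank_adjoin_sub_eq_72 {k Ω : Type*} [Field k] [Field Ω] [IsAlgClosed Ω] [Algebra k Ω]
    [Algebra (Polynomial (MvPolynomial (Fin 2) ℚ)) k]
    [IsFractionRing (Polynomial (MvPolynomial (Fin 2) ℚ)) k] {x y t : k}
    (hx : algebraMap _ k (Polynomial.C (X 0) : Polynomial (MvPolynomial (Fin 2) ℚ)) = x)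
    (hy : algebraMap _ k (Polynomial.C (X 1) : Polynomial (MvPolynomial (Fin 2) ℚ)) = y)
    (ht : algebraMap _ k (Polynomial.X : Polynomial (MvPolynomial (Fin 2) ℚ)) = t) {η l α : Ω}
    (hη : etaRel (algebraMap k Ω t) η = 0)
    (hl : invCubic (algebraMap k Ω t) η (invX (algebraMap k Ω t) (algebraMap k Ω x)) l = 0)
    (hα : invCubic (algebraMap k Ω t) η (invY (algebraMap k Ω t) (algebraMap k Ω y)) α = 0) :
    Module.finrank k (IntermediateField.adjoin k {α - l}) = 72 := by
  have hinjk := IsFractionRing.injective (Polynomial (MvPolynomial (Fin 2) ℚ)) k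
  have : CharZero k := charZero_of_injective_algebraMap hinjk
  have : CharZero Ω := charZero_of_injective_algebraMap (algebraMap k Ω).injective
  let g : Polynomial (MvPolynomial (Fin 2) ℚ) →+* Ω := (algebraMap k Ω).comp (algebraMap _ k)
  have hg : Function.Injective g := (algebraMap k Ω).injective.comp hinjk
  have hgx : g (Polynomial.C (X 0)) = algebraMap k Ω x := by rw [← hx]; rfl
  have hgy : g (Polynomial.C (X 1)) = algebraMap k Ω y := by rw [← hy]; rfl
  have hgt : g Polynomial.X = algebraMap k Ω t := by rw [← ht]; rfl
  let G : MvPolynomial (Option (Fin 2)) ℚ →ₐ[ℚ] Ω :=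
    (g.comp (optionEquivLeft ℚ (Fin 2) : MvPolynomial (Option (Fin 2)) ℚ →+* _)).toRatAlgHom
  have hG : ∀ p, G p = g (optionEquivLeft ℚ (Fin 2) p) := fun p => rfl
  have hGinj : Function.Injective G := hg.comp (optionEquivLeft ℚ (Fin 2)).injective
  have hind : AlgebraicIndependent ℚ (G ∘ X) :=
    (MvPolynomial.algebraicIndependent_X (Option (Fin 2)) ℚ).map' hGinj
  have hG0 : (G ∘ X) (some 0) = algebraMap k Ω x := by simp [hG, hgx]
  have hG1 : (G ∘ X) (some 1) = algebraMap k Ω y := by simp [hG, hgy]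
  have hGn : (G ∘ X) none = algebraMap k Ω t := by simp [hG, hgt]
  have hmem : ∀ K : Subfield Ω, algebraMap k Ω x ∈ K → algebraMap k Ω y ∈ K →
      algebraMap k Ω t ∈ K → ∀ z : k, algebraMap k Ω z ∈ K := fun K h1 h2 h3 =>
    algebraMap_mem_of_isFractionRing K
      (range_le_subfield g K (hgx ▸ h1) (hgy ▸ h2) (hgt ▸ h3))
  obtain ⟨F₁, hF₁, hx₁, hS₁⟩ := exists_isAlgClosed_transcendental
    (hind.transcendental_adjoin (s := {some 1, none}) (i := some 0) (by simp))
  obtain ⟨F₂, hF₂, hy₂, hS₂⟩ := exists_isAlgClosed_transcendental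
    (hind.transcendental_adjoin (s := {some 0, none}) (i := some 1) (by simp))
  rw [Set.image_pair, hGn] at hS₁ hS₂
  rw [hG0] at hx₁ hS₂
  rw [hG1] at hy₂ hS₁
  have hy₁ : algebraMap k Ω y ∈ F₁ := hS₁ (by simp)
  have ht₁ : algebraMap k Ω t ∈ F₁ := hS₁ (by simp)
  have hx₂ : algebraMap k Ω x ∈ F₂ := hS₂ (by simp)
  have ht₂ : algebraMap k Ω t ∈ F₂ := hS₂ (by simp)
  have ht0 : t ≠ 0 := by
    rw [← ht]
    exact (map_ne_zero_iff _ hinjk).mpr Polynomial.X_ne_zero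
  have hoct : Irreducible (octic t) := by
    rw [← ht]
    exact irreducible_octic (Polynomial.eval₂RingHom (eval₂Hom (RingHom.id ℚ) 0) 2)
      (Polynomial.eval₂_X _ _)
  exact finrank_adjoin_sub (F₁ := F₁) (F₂ := F₂) hx₁ hy₂
    (hmem (IntermediateField.adjoin F₁ _).toSubfield
      (IntermediateField.mem_adjoin_simple_self F₁ _)
      ((IntermediateField.adjoin F₁ _).algebraMap_mem ⟨_, hy₁⟩)
      ((IntermediateField.adjoin F₁ _).algebraMap_mem ⟨_, ht₁⟩))
    (hmem (IntermediateField.adjoin F₂ _).toSubfield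
      ((IntermediateField.adjoin F₂ _).algebraMap_mem ⟨_, hx₂⟩)
      (IntermediateField.mem_adjoin_simple_self F₂ _)
      ((IntermediateField.adjoin F₂ _).algebraMap_mem ⟨_, ht₂⟩))
    (t₁ := ⟨_, ht₁⟩) (y₁ := ⟨_, hy₁⟩) rfl rfl (t₂ := ⟨_, ht₂⟩) (x₂ := ⟨_, hx₂⟩) rfl rfl
    ht0 hoct hη hl hα

/-- The coefficient of `x ^ i * y ^ j`. -/
noncomputable def coeffXY (i j : ℕ) : MvPolynomial (Fin 2) ℚ →ₗ[ℚ] ℚ :=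
  lcoeff ℚ (Finsupp.single 0 i + Finsupp.single 1 j)

theorem ext_coeffXY {p q : MvPolynomial (Fin 2) ℚ}
    (h : ∀ i j, coeffXY i j p = coeffXY i j q) : p = q := by
  ext m
  have hm : m = Finsupp.single 0 (m 0) + Finsupp.single 1 (m 1) := by
    ext a
    fin_cases a <;> simp
  rw [hm]
  exact h _ _

theorem coeffXY_zero_X_mul (j : ℕ) (p : MvPolynomial (Fin 2) ℚ) :
    coeffXY 0 j (X 0 * p) = 0 := by
  simp [coeffXY, coeff_X_mul']

theorem coeffXY_X_mul_zero (i : ℕ) (p : MvPolynomial (Fin 2) ℚ) :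
    coeffXY i 0 (X 1 * p) = 0 := by
  simp [coeffXY, coeff_X_mul']

theorem coeffXY_succ_X_mul (i j : ℕ) (p : MvPolynomial (Fin 2) ℚ) :
    coeffXY (i + 1) j (X 0 * p) = coeffXY i j p := by
  simp only [coeffXY, lcoeff_apply]
  rw [show (Finsupp.single (0 : Fin 2) (i + 1) + Finsupp.single 1 j) =
    Finsupp.single 0 1 + (Finsupp.single 0 i + Finsupp.single 1 j) by
      rw [Finsupp.single_add]; abel, coeff_X_mul]

theorem coeffXY_X_mul_succ (i j : ℕ) (p : MvPolynomial (Fin 2) ℚ) :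
    coeffXY i (j + 1) (X 1 * p) = coeffXY i j p := by
  simp only [coeffXY, lcoeff_apply]
  rw [show (Finsupp.single (0 : Fin 2) i + Finsupp.single 1 (j + 1)) =
    Finsupp.single 1 1 + (Finsupp.single 0 i + Finsupp.single 1 j) by
      rw [Finsupp.single_add]; abel, coeff_X_mul]

theorem coeffXY_monomial (i j a b : ℕ) :
    coeffXY i j (X 0 ^ a * X 1 ^ b) = if i = a ∧ j = b then 1 else 0 := by
  induction a generalizing i with
  | zero =>
    induction b generalizing j with
    | zero =>
      simp only [coeffXY, lcoeff_apply, pow_zero, mul_one, coeff_one]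
      congr 1
      simp [Finsupp.ext_iff, Fin.forall_fin_two, eq_comm]
    | succ b ih =>
      rw [pow_succ', mul_left_comm]
      cases j
      · simp [coeffXY_X_mul_zero]
      · rw [coeffXY_X_mul_succ, ih]
        simp
  | succ a ih =>
    rw [pow_succ', mul_assoc]
    cases i <;> simp [coeffXY_zero_X_mul, coeffXY_succ_X_mul, ih]

theorem gesselCount_eq_zero (n : ℕ) : ∀ i j : ℕ, n < i ∨ n < j → gesselCount n i j = 0 := by
  induction n with
  | zero =>
    intro i j h
    rw [gesselCount, if_neg (by lia)]
  | succ n ih =>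
    intro i j h
    rw [gesselCount, ih (i - 1) j (by lia), ih (i - 1) (j - 1) (by lia), ih (i + 1) j (by lia),
      ih (i + 1) (j + 1) (by lia)]
    simp

theorem coeffXY_Qfull (n i j : ℕ) :
    coeffXY i j (PowerSeries.coeff n Qfull) = gesselCount n i j := by
  have h : ∀ a b : ℕ, coeffXY i j ((gesselCount n a b : MvPolynomial (Fin 2) ℚ) * X 0 ^ a *
      X 1 ^ b) = if i = a then (if j = b then (gesselCount n a b : ℚ) else 0) else 0 := by
    intro a b
    rw [mul_assoc, ← nsmul_eq_mul, map_nsmul, coeffXY_monomial]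
    split_ifs <;> simp_all
  simp only [Qfull, PowerSeries.coeff_mk, map_sum, h]
  by_cases hi : n < i
  · rw [gesselCount_eq_zero n i j (.inl hi)]
    refine Finset.sum_eq_zero fun a ha => Finset.sum_eq_zero fun b _ => ?_
    have := Finset.mem_range.mp ha
    rw [if_neg (by lia : ¬ i = a)]
  by_cases hj : n < j
  · rw [gesselCount_eq_zero n i j (.inr hj)]
    refine Finset.sum_eq_zero fun a _ => Finset.sum_eq_zero fun b hb => ?_
    have := Finset.mem_range.mp hb
    rw [if_neg (by lia : ¬ j = b)]
    simp
  simp only [Finset.sum_ite_irrel, Finset.sum_const_zero]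
  rw [Finset.sum_ite_eq, if_pos (by simp; lia), Finset.sum_ite_eq, if_pos (by simp; lia)]

/-- Walks ending on the `x`-axis. -/
noncomputable def gesselX : PowerSeries (Polynomial ℚ) :=
  PowerSeries.map (aeval ![Polynomial.X, 0] : MvPolynomial (Fin 2) ℚ →ₐ[ℚ] Polynomial ℚ) Qfull

/-- Walks ending on the `y`-axis. -/
noncomputable def gesselY : PowerSeries (Polynomial ℚ) :=
  PowerSeries.map (aeval ![0, Polynomial.X] : MvPolynomial (Fin 2) ℚ →ₐ[ℚ] Polynomial ℚ) Qfull

/-- Walks ending at the origin. -/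
noncomputable def gesselO : PowerSeries ℚ :=
  PowerSeries.map (aeval ![0, 0] : MvPolynomial (Fin 2) ℚ →ₐ[ℚ] ℚ) Qfull

/-- Substitution of the variable `i`. -/
noncomputable def inVar (i : Fin 2) :
    PowerSeries (Polynomial ℚ) →+* PowerSeries (MvPolynomial (Fin 2) ℚ) :=
  PowerSeries.map (Polynomial.aeval (X i) : Polynomial ℚ →ₐ[ℚ] MvPolynomial (Fin 2) ℚ)

/-- The inclusion of power series with constant coefficients. -/
noncomputable def ofConst : PowerSeries ℚ →+* PowerSeries (MvPolynomial (Fin 2) ℚ) :=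
  PowerSeries.map C

theorem MvPolynomial.induction_XY {P : MvPolynomial (Fin 2) ℚ → Prop} (p : MvPolynomial (Fin 2) ℚ)
    (hadd : ∀ p q, P p → P q → P (p + q))
        (hmon : ∀ (c : ℚ) (a b : ℕ), P (c • (X 0 ^ a * X 1 ^ b))) :
    P p := by
  induction p using MvPolynomial.induction_on' with
  | add p q hp hq => exact hadd p q hp hq
  | monomial m c =>
    rw [monomial_eq, ← smul_eq_C_mul, Finsupp.prod_fintype _ _ (by simp), Fin.prod_univ_two]
    exact hmon _ _ _

theorem coeffXY_evalX (i j : ℕ) (p : MvPolynomial (Fin 2) ℚ) :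
    coeffXY i j (Polynomial.aeval (X 0 : MvPolynomial (Fin 2) ℚ)
      (aeval ![(Polynomial.X : Polynomial ℚ), 0] p)) = if j = 0 then coeffXY i 0 p else 0 := by
  induction p using MvPolynomial.induction_XY with
  | hadd p q hp hq =>
    simp only [map_add, hp, hq]
    split_ifs <;> simp
  | hmon c a b =>
    have := coeffXY_monomial i j a 0
    cases b <;> simp_all [coeffXY_monomial]
    split_ifs <;> simp_all

theorem coeffXY_evalY (i j : ℕ) (p : MvPolynomial (Fin 2) ℚ) :
    coeffXY i j (Polynomial.aeval (X 1 : MvPolynomial (Fin 2) ℚ)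
      (aeval ![0, (Polynomial.X : Polynomial ℚ)] p)) = if i = 0 then coeffXY 0 j p else 0 := by
  induction p using MvPolynomial.induction_XY with
  | hadd p q hp hq =>
    simp only [map_add, hp, hq]
    split_ifs <;> simp
  | hmon c a b =>
    have := coeffXY_monomial i j 0 b
    cases a <;> simp_all [coeffXY_monomial]
    split_ifs <;> simp_all

theorem coeffXY_evalO (i j : ℕ) (p : MvPolynomial (Fin 2) ℚ) :
    coeffXY i j (C (aeval ![(0 : ℚ), 0] p)) = if i = 0 ∧ j = 0 then coeffXY 0 0 p else 0 := by
  induction p using MvPolynomial.induction_XY with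
  | hadd p q hp hq =>
    simp only [map_add, hp, hq]
    split_ifs <;> simp
  | hmon c a b =>
    have h1 := coeffXY_monomial i j 0 0
    have h2 := coeffXY_monomial 0 0 a b
    have h : C (σ := Fin 2) c = c • 1 := by rw [smul_eq_C_mul, mul_one]
    cases a <;> cases b <;> simp_all [coeffXY_monomial]

theorem coeff_succ_Qfull (n : ℕ) :
    X 0 * (X 1 * PowerSeries.coeff (n + 1) Qfull) =
      X 0 * (X 0 * (X 1 * PowerSeries.coeff n Qfull)) +
      X 0 * (X 0 * (X 1 * (X 1 * PowerSeries.coeff n Qfull))) +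
      X 1 * PowerSeries.coeff n Qfull + PowerSeries.coeff n Qfull -
      (PowerSeries.coeff n (inVar 1 gesselY) + X 1 * PowerSeries.coeff n (inVar 1 gesselY)) -
      PowerSeries.coeff n (inVar 0 gesselX) + PowerSeries.coeff n (ofConst gesselO) := by
  refine ext_coeffXY fun i j => ?_
  have hG : ∀ i j, coeffXY i j (PowerSeries.coeff n (inVar 1 gesselY)) =
      if i = 0 then (gesselCount n 0 j : ℚ) else 0 := fun i j => by
    rw [← coeffXY_Qfull, ← coeffXY_evalY]; rfl
  have hF : ∀ i j, coeffXY i j (PowerSeries.coeff n (inVar 0 gesselX)) =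
      if j = 0 then (gesselCount n i 0 : ℚ) else 0 := fun i j => by
    rw [← coeffXY_Qfull, ← coeffXY_evalX]; rfl
  have hO : ∀ i j, coeffXY i j (PowerSeries.coeff n (ofConst gesselO)) =
      if i = 0 ∧ j = 0 then (gesselCount n 0 0 : ℚ) else 0 := fun i j => by
    rw [← coeffXY_Qfull, ← coeffXY_evalO]; rfl
  have hQ := coeffXY_Qfull n
  have hQ' := coeffXY_Qfull (n + 1)
  obtain _ | _ | i := i <;> obtain _ | _ | j := j <;>
    simp only [map_add, map_sub, coeffXY_succ_X_mul, coeffXY_X_mul_succ, coeffXY_zero_X_mul,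
      coeffXY_X_mul_zero, hG, hF, hO, hQ, hQ', zero_add] <;>
    simp [gesselCount] <;> ring

section identities

variable {A : Type*} [CommRing A]

/-- The kernel of the functional equation. -/
def kernel (x y t : A) : A := x * y - t * (1 + y) * (1 + x ^ 2 * y)

/-- The decoupled polynomial invariant in `x`; the arguments are the iterated quotients of the
series of walks ending on the `x`-axis. -/
def pairedX (t G₀ f₁ x F₂ F₁ F : A) : A :=
  2 * t ^ 2 * F₂ + 3 * t ^ 3 * F₁ * (F + G₀) - (2 * (1 + 2 * t ^ 2 * G₀) - 1) * t * F₁ +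
    t ^ 4 * F ^ 3 - (1 + 2 * t ^ 2 * G₀) * t ^ 2 * F ^ 2 +
    t ^ 2 * (-2 * t * f₁ + G₀ + t ^ 2 * G₀ ^ 2) * F + 1 + x * (t * F - t) - t * x ^ 2 * (t * F)

theorem pairedX_eq {t G₀ f₁ x F₂ F₁ F : A} (h1 : F = G₀ + x * F₁) (h2 : F₁ = f₁ + x * F₂) :
    x ^ 3 * pairedX t G₀ f₁ x F₂ F₁ F = t * (1 + t * x * F) ^ 3 -
      (1 + 2 * t ^ 2 * G₀) * x * (1 + t * x * F) ^ 2 +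
      (t * (-2 * t * f₁ + G₀ + t ^ 2 * G₀ ^ 2 + 2) * x ^ 2 - t * (x ^ 2 + 1) ^ 2 +
        x * (x ^ 2 + 1)) * (1 + t * x * F) := by
  subst h2 h1
  unfold pairedX
  ring

/-- The decoupled polynomial invariant in `y`. -/
def pairedY (t G₀ f₁ y Gy G' G : A) : A :=
  t ^ 2 * (3 * G * (1 + t ^ 2 * G₀ - t ^ 2 * (1 + y) * G + (1 + t ^ 2 * G₀)) -
      2 * (1 + 2 * t ^ 2 * G₀) * G - G - 2 * G') +
    (1 + t ^ 2 * G₀ - t ^ 2 * (1 + y) * G) ^ 3 -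
    (1 + 2 * t ^ 2 * G₀) * (1 + t ^ 2 * G₀ - t ^ 2 * (1 + y) * G) ^ 2 +
    t ^ 2 * (-2 * t * f₁ + G₀ + t ^ 2 * G₀ ^ 2 + 2 - 4) * (1 + t ^ 2 * G₀ - t ^ 2 * (1 + y) * G) +
    t ^ 2 * (1 + y) - t ^ 4 * (1 + y) ^ 2 * (G + Gy)

theorem pairedY_eq {t G₀ f₁ y Gy G' G : A} (h1 : G = G₀ + y * Gy)
    (h2 : G = 1 + t * f₁ + (1 + y) * G') :
    (1 + y) ^ 3 * y * pairedY t G₀ f₁ y Gy G' G =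
      y * (y - t ^ 2 * (1 + y) ^ 2 * G + t ^ 2 * (1 + y) * G₀) ^ 3 -
      (1 + 2 * t ^ 2 * G₀) * (1 + y) * y *
        (y - t ^ 2 * (1 + y) ^ 2 * G + t ^ 2 * (1 + y) * G₀) ^ 2 +
      (t ^ 2 * (1 + y) ^ 2 * y * (-2 * t * f₁ + G₀ + t ^ 2 * G₀ ^ 2 + 2) + y ^ 2 +
        t ^ 2 * (1 + y) ^ 4 - 4 * t ^ 2 * (1 + y) ^ 2 * y) *
        (y - t ^ 2 * (1 + y) ^ 2 * G + t ^ 2 * (1 + y) * G₀) := by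
  obtain rfl : G₀ = G - y * Gy := by linear_combination -h1
  have h3 : -2 * t * f₁ = -2 * (G - 1 - (1 + y) * G') := by linear_combination 2 * h2
  rw [pairedY, h3]
  ring

theorem kernel_dvd {x y t Q F G G₀ a b : A}
    (h : kernel x y t * Q = x * y - t * (1 + y) * G - t * F + t * G₀) :
    kernel x y t ∣ (1 + y) ^ 3 * y * t ^ 2 *
        (t * (1 + t * x * F) ^ 3 - a * x * (1 + t * x * F) ^ 2 +
      (t * b * x ^ 2 - t * (x ^ 2 + 1) ^ 2 + x * (x ^ 2 + 1)) * (1 + t * x * F)) -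
      x ^ 3 * (y * (y - t ^ 2 * (1 + y) ^ 2 * G + t ^ 2 * (1 + y) * G₀) ^ 3 -
      a * (1 + y) * y * (y - t ^ 2 * (1 + y) ^ 2 * G + t ^ 2 * (1 + y) * G₀) ^ 2 +
      (t ^ 2 * (1 + y) ^ 2 * y * b + y ^ 2 +
        t ^ 2 * (1 + y) ^ 4 - 4 * t ^ 2 * (1 + y) ^ 2 * y) *
        (y - t ^ 2 * (1 + y) ^ 2 * G + t ^ 2 * (1 + y) * G₀)) := by
  set L := 1 + t * x * F with hL
  set B := y - t ^ 2 * (1 + y) ^ 2 * G + t ^ 2 * (1 + y) * G₀ with hB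
  have h3 : t * (1 + y) * L - x * B = -(kernel x y t * (t * x * (1 + y) * Q + 1)) := by
    rw [hL, hB]
    unfold kernel at *
    linear_combination (t * x * (1 + y)) * h
  set u := t * (1 + y) * L with hu
  set w := x * B with hw
  refine ⟨-(t * x * (1 + y) * Q + 1) *
      (y * (u ^ 2 + u * w + w ^ 2) - a * x * (1 + y) * y * (u + w) +
    (t * b * x ^ 2 - t * (x ^ 2 + 1) ^ 2 + x * (x ^ 2 + 1)) * (t * (1 + y) ^ 2 * y)) -
    (x * y - t * (1 + y) * (x ^ 2 + y)) * w, ?_⟩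
  unfold kernel at *
  linear_combination (y * (u ^ 2 + u * w + w ^ 2) - a * x * (1 + y) * y * (u + w) +
    (t * b * x ^ 2 - t * (x ^ 2 + 1) ^ 2 + x * (x ^ 2 + 1)) * (t * (1 + y) ^ 2 * y)) * h3

end identities

theorem functional_equation :
    kernel (PowerSeries.C (X 0)) (PowerSeries.C (X 1)) PowerSeries.X * Qfull =
      PowerSeries.C (X 0) * PowerSeries.C (X 1) -
        PowerSeries.X * (1 + PowerSeries.C (X 1)) * inVar 1 gesselY -
        PowerSeries.X * inVar 0 gesselX + PowerSeries.X * ofConst gesselO := by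
  have h : PowerSeries.C (X 0) * (PowerSeries.C (X 1) * Qfull) =
      PowerSeries.C (X 0) * PowerSeries.C (X 1) + PowerSeries.X *
        (PowerSeries.C (X 0) * (PowerSeries.C (X 0) * (PowerSeries.C (X 1) * Qfull)) +
        PowerSeries.C (X 0) * (PowerSeries.C (X 0) * (PowerSeries.C (X 1) *
          (PowerSeries.C (X 1) * Qfull))) +
        PowerSeries.C (X 1) * Qfull + Qfull -
        (inVar 1 gesselY + PowerSeries.C (X 1) * inVar 1 gesselY) -
        inVar 0 gesselX + ofConst gesselO) := by
    ext1 n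
    cases n with
    | zero =>
      rw [map_add, PowerSeries.coeff_zero_X_mul]
      simp [Qfull, gesselCount, ← map_mul]
    | succ n =>
      rw [map_add, PowerSeries.coeff_succ_X_mul]
      simp only [map_add, map_sub, PowerSeries.coeff_C_mul, ← map_mul PowerSeries.C]
      rw [coeff_succ_Qfull]
      simp
  unfold kernel
  linear_combination h

theorem PowerSeries.exists_eq_eval_add (f : PowerSeries (Polynomial ℚ)) (c : ℚ) :
    ∃ g, f = PowerSeries.map Polynomial.C (PowerSeries.map (Polynomial.evalRingHom c) f) +
      PowerSeries.C (Polynomial.X - Polynomial.C c) * g := by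
  choose g hg using fun n => Polynomial.X_sub_C_dvd_sub_C_eval (a := c) (p := PowerSeries.coeff n f)
  refine ⟨PowerSeries.mk g, ?_⟩
  ext1 n
  rw [map_add, PowerSeries.coeff_C_mul, PowerSeries.coeff_mk, ← hg]
  simp

section eval

/-- Evaluate the two variables at univariate polynomials. -/
noncomputable def evalVars (p q : Polynomial ℚ) :
    PowerSeries (MvPolynomial (Fin 2) ℚ) →+* PowerSeries (Polynomial ℚ) :=
  PowerSeries.map (aeval ![p, q] : MvPolynomial (Fin 2) ℚ →ₐ[ℚ] Polynomial ℚ)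

theorem evalVars_X (p q : Polynomial ℚ) : evalVars p q PowerSeries.X = PowerSeries.X := by
  simp [evalVars]

theorem evalVars_C (p q : Polynomial ℚ) (r : MvPolynomial (Fin 2) ℚ) :
    evalVars p q (PowerSeries.C r) = PowerSeries.C (aeval ![p, q] r) := by
  simp [evalVars]

theorem evalVars_inVar (p q : Polynomial ℚ) (i : Fin 2) (f : PowerSeries (Polynomial ℚ)) :
    evalVars p q (inVar i f) =
      PowerSeries.map (Polynomial.compRingHom (![p, q] i)) f := by
  ext1 n
  simp only [evalVars, inVar, PowerSeries.coeff_map]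
  generalize PowerSeries.coeff n f = r
  change aeval ![p, q] (Polynomial.aeval (X i) r) = r.comp (![p, q] i)
  rw [← Polynomial.aeval_algHom_apply, aeval_X, Polynomial.comp_eq_aeval]

theorem map_comp_X (f : PowerSeries (Polynomial ℚ)) :
    PowerSeries.map (Polynomial.compRingHom Polynomial.X) f = f := by
  ext1 n
  simp

theorem map_comp_C (f : PowerSeries (Polynomial ℚ)) (c : ℚ) :
    PowerSeries.map (Polynomial.compRingHom (Polynomial.C c)) f =
      PowerSeries.map Polynomial.C (PowerSeries.map (Polynomial.evalRingHom c) f) := by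
  ext1 n
  simp

theorem evalVars_ofConst (p q : Polynomial ℚ) (f : PowerSeries ℚ) :
    evalVars p q (ofConst f) = PowerSeries.map Polynomial.C f := by
  ext1 n
  simp [evalVars, ofConst]

theorem inVar_C (i : Fin 2) (p : Polynomial ℚ) :
    inVar i (PowerSeries.C p) = PowerSeries.C (Polynomial.aeval (X i) p) := by
  simp [inVar]

theorem inVar_X (i : Fin 2) : inVar i PowerSeries.X = PowerSeries.X := by
  simp [inVar]

theorem inVar_map_C (i : Fin 2) (f : PowerSeries ℚ) :
    inVar i (PowerSeries.map Polynomial.C f) = ofConst f := by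
  ext1 n
  simp [inVar, ofConst]

theorem map_eval_evalVars (p q : Polynomial ℚ) (c a b : ℚ) (hp : p.eval c = a) (hq : q.eval c = b)
    (f : PowerSeries (MvPolynomial (Fin 2) ℚ)) :
    PowerSeries.map (Polynomial.evalRingHom c) (evalVars p q f) =
      PowerSeries.map (aeval ![a, b] : MvPolynomial (Fin 2) ℚ →ₐ[ℚ] ℚ) f := by
  ext1 n
  simp only [evalVars, PowerSeries.coeff_map]
  generalize PowerSeries.coeff n f = r
  induction r using MvPolynomial.induction_XY with
  | hadd p q hp hq => simp only [map_add, hp, hq]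
  | hmon d i j => simp [hp, hq]

end eval

theorem eval_gesselX : PowerSeries.map (Polynomial.evalRingHom 0) gesselX = gesselO :=
  map_eval_evalVars Polynomial.X 0 0 0 0 (by simp) (by simp) Qfull

theorem eval_gesselY : PowerSeries.map (Polynomial.evalRingHom 0) gesselY = gesselO :=
  map_eval_evalVars 0 Polynomial.X 0 0 0 (by simp) (by simp) Qfull

theorem eval_neg_one_gesselY {F₁ : PowerSeries (Polynomial ℚ)}
    (h : gesselX = PowerSeries.map Polynomial.C gesselO + PowerSeries.C Polynomial.X * F₁) :
    PowerSeries.map (Polynomial.evalRingHom (-1)) gesselY =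
      1 + PowerSeries.X * PowerSeries.map (Polynomial.evalRingHom 0) F₁ := by
  have h1 := congrArg (evalVars Polynomial.X (-1)) functional_equation
  simp only [kernel, map_mul, map_sub, map_add, map_one, map_pow, evalVars_C, evalVars_X,
    evalVars_inVar, evalVars_ofConst, aeval_X] at h1
  simp only [Matrix.cons_val_zero, Matrix.cons_val_one, map_comp_X, map_neg, map_one] at h1
  have h2 : PowerSeries.C Polynomial.X * evalVars Polynomial.X (-1) Qfull =
      PowerSeries.C Polynomial.X * (1 + PowerSeries.X * F₁) := by
    linear_combination -h1 + PowerSeries.X * h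
  have h3 := mul_left_cancel₀ ((map_ne_zero_iff _ PowerSeries.C_injective).mpr Polynomial.X_ne_zero) h2
  have h4 := congrArg (PowerSeries.map (Polynomial.evalRingHom 0)) h3
  rw [map_eval_evalVars _ _ _ 0 (-1) (by simp) (by simp)] at h4
  rw [show gesselY = evalVars 0 Polynomial.X Qfull from rfl,
    map_eval_evalVars _ _ _ 0 (-1) (by simp) (by simp), h4]
  simp

theorem dvd_of_dvd_C_mul {π : MvPolynomial (Fin 2) ℚ} {p q : Polynomial ℚ} (i : Fin 2)
    (hπ : aeval ![p, q] π = 0) (hπ0 : π ≠ 0)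
    (h0 : π ∣ X 0 - Polynomial.aeval (X i) p) (h1 : π ∣ X 1 - Polynomial.aeval (X i) q)
    {K z : PowerSeries (MvPolynomial (Fin 2) ℚ)} (hK : evalVars p q K ≠ 0)
    (h : K ∣ PowerSeries.C π * z) : K ∣ z := by
  obtain ⟨r, hr⟩ := h
  have h2 : evalVars p q r = 0 := by
    have := congrArg (evalVars p q) hr
    rw [map_mul, map_mul, evalVars_C, hπ, map_zero, zero_mul, eq_comm] at this
    exact (mul_eq_zero.mp this).resolve_left hK
  have h3 : ∀ s : MvPolynomial (Fin 2) ℚ, π ∣ s - Polynomial.aeval (X i) (aeval ![p, q] s) := by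
    intro s
    have : Ideal.Quotient.mkₐ ℚ (Ideal.span {π}) = (Ideal.Quotient.mkₐ ℚ (Ideal.span {π})).comp
        ((Polynomial.aeval (X i)).comp (aeval ![p, q])) := by
      ext a
      fin_cases a
      · simpa [Ideal.Quotient.eq, Ideal.mem_span_singleton] using h0
      · simpa [Ideal.Quotient.eq, Ideal.mem_span_singleton] using h1
    simpa [Ideal.Quotient.eq, Ideal.mem_span_singleton] using congrArg (fun f => f s) this
  have h4 : ∀ n, π ∣ PowerSeries.coeff n r := by
    intro n
    have h5 : aeval ![p, q] (PowerSeries.coeff n r) = 0 := by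
      simpa [evalVars] using congrArg (PowerSeries.coeff n) h2
    simpa [h5] using h3 (PowerSeries.coeff n r)
  choose s hs using h4
  refine ⟨PowerSeries.mk s, ?_⟩
  have hπ' : PowerSeries.C π ≠ 0 := (map_ne_zero_iff _ PowerSeries.C_injective).mpr hπ0
  refine mul_left_cancel₀ hπ' ?_
  rw [hr, mul_left_comm]
  congr 1
  ext1 n
  simp [hs]

theorem eq_zero_of_kernel_mul {f g : PowerSeries (Polynomial ℚ)}
    {R : PowerSeries (MvPolynomial (Fin 2) ℚ)}
    (h : inVar 0 f - inVar 1 g =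
      kernel (PowerSeries.C (X 0)) (PowerSeries.C (X 1)) PowerSeries.X * R) : R = 0 := by
  have h1 : ∀ n, PowerSeries.X ^ n ∣ R := by
    intro n
    induction n with
    | zero => simp
    | succ n ih =>
      obtain ⟨S, rfl⟩ := ih
      rw [pow_succ]
      refine mul_dvd_mul_left _ (PowerSeries.X_dvd_iff.mpr ?_)
      have h2 := congrArg (PowerSeries.coeff n) h
      rw [mul_left_comm, PowerSeries.coeff_X_pow_mul' , if_pos le_rfl, Nat.sub_self] at h2
      have h3 : X 0 * (X 1 * PowerSeries.constantCoeff S) =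
          Polynomial.aeval (X 0 : MvPolynomial (Fin 2) ℚ) (PowerSeries.coeff n f) -
          Polynomial.aeval (X 1 : MvPolynomial (Fin 2) ℚ) (PowerSeries.coeff n g) := by
        simpa [kernel, inVar, mul_assoc] using h2.symm
      refine ext_coeffXY fun i j => ?_
      have h4 : ∀ p : Polynomial ℚ, coeffXY (i + 1) (j + 1)
          (Polynomial.aeval (X 0 : MvPolynomial (Fin 2) ℚ) p) = 0 := by
        intro p
        have := coeffXY_evalX (i + 1) (j + 1)
          (Polynomial.aeval (X 0 : MvPolynomial (Fin 2) ℚ) p)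
        simpa [← Polynomial.aeval_algHom_apply] using this
      have h5 : ∀ p : Polynomial ℚ, coeffXY (i + 1) (j + 1)
          (Polynomial.aeval (X 1 : MvPolynomial (Fin 2) ℚ) p) = 0 := by
        intro p
        have := coeffXY_evalY (i + 1) (j + 1)
          (Polynomial.aeval (X 1 : MvPolynomial (Fin 2) ℚ) p)
        simpa [← Polynomial.aeval_algHom_apply] using this
      have h6 := congrArg (coeffXY (i + 1) (j + 1)) h3
      rw [coeffXY_succ_X_mul, coeffXY_X_mul_succ, map_sub, h4, h5, sub_zero] at h6
      rw [h6, map_zero]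
  ext1 n
  exact PowerSeries.X_pow_dvd_iff.mp (h1 (n + 1)) n (Nat.lt_succ_self n)

theorem eq_const_of_inVar_eq {f g : PowerSeries (Polynomial ℚ)}
    (h : PowerSeries.X ^ 2 * inVar 0 f = inVar 1 g) :
    ∃ c, f = PowerSeries.map Polynomial.C c ∧
      g = PowerSeries.X ^ 2 * PowerSeries.map Polynomial.C c := by
  have h1 := congrArg (evalVars Polynomial.X (Polynomial.C 0)) h
  have h2 := congrArg (evalVars (Polynomial.C 0) Polynomial.X) h
  simp only [map_mul, map_pow, evalVars_X, evalVars_inVar, Matrix.cons_val_zero,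
    Matrix.cons_val_one, map_comp_X, map_comp_C] at h1 h2
  refine ⟨PowerSeries.map (Polynomial.evalRingHom 0) f, ?_, h2.symm⟩
  have h3 : PowerSeries.map (Polynomial.evalRingHom 0) g =
      PowerSeries.X ^ 2 * PowerSeries.map (Polynomial.evalRingHom 0) f := by
    rw [← h2, map_mul, map_pow, PowerSeries.map_X]
    congr 1
    ext1 n
    simp
  rw [h3] at h1
  refine mul_left_cancel₀ (pow_ne_zero 2 PowerSeries.X_ne_zero) (h1.trans ?_)
  simp

theorem kernel_dvd_of_dvd_X {z : PowerSeries (MvPolynomial (Fin 2) ℚ)}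
    (h : kernel (PowerSeries.C (X 0)) (PowerSeries.C (X 1)) PowerSeries.X ∣
      PowerSeries.C (X 0) * z) :
    kernel (PowerSeries.C (X 0)) (PowerSeries.C (X 1)) PowerSeries.X ∣ z := by
  refine dvd_of_dvd_C_mul (p := 0) (q := Polynomial.X) 1 (by simp) (X_ne_zero 0) (by simp)
    (by simp) (fun h0 => ?_) h
  have := congrArg (PowerSeries.map (Polynomial.evalRingHom 0)) h0
  simp [kernel, evalVars_C, evalVars_X] at this

theorem kernel_dvd_of_dvd_Y {z : PowerSeries (MvPolynomial (Fin 2) ℚ)}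
    (h : kernel (PowerSeries.C (X 0)) (PowerSeries.C (X 1)) PowerSeries.X ∣
      PowerSeries.C (X 1) * z) :
    kernel (PowerSeries.C (X 0)) (PowerSeries.C (X 1)) PowerSeries.X ∣ z := by
  refine dvd_of_dvd_C_mul (p := Polynomial.X) (q := 0) 0 (by simp) (X_ne_zero 1) (by simp)
    (by simp) (fun h0 => ?_) h
  have := congrArg (PowerSeries.map (Polynomial.evalRingHom 0)) h0
  simp [kernel, evalVars_C, evalVars_X] at this

theorem kernel_dvd_of_dvd_one_add_Y {z : PowerSeries (MvPolynomial (Fin 2) ℚ)}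
    (h : kernel (PowerSeries.C (X 0)) (PowerSeries.C (X 1)) PowerSeries.X ∣
      (1 + PowerSeries.C (X 1)) * z) :
    kernel (PowerSeries.C (X 0)) (PowerSeries.C (X 1)) PowerSeries.X ∣ z := by
  rw [← map_one PowerSeries.C, ← map_add] at h
  have h1 : (1 + X 1 : MvPolynomial (Fin 2) ℚ) ≠ 0 := by
    intro h0
    simpa using congrArg (aeval ![(0 : ℚ), 0]) h0
  refine dvd_of_dvd_C_mul (p := Polynomial.X) (q := -1) 0 (by simp) h1 (by simp)
    (by simp [add_comm]) (fun h0 => ?_) h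
  have := congrArg (PowerSeries.map (Polynomial.evalRingHom 1)) h0
  simp [kernel, evalVars_C, evalVars_X] at this

/-- The equations obtained from the decoupled invariants. -/
theorem exists_cubic_equations : ∃ a b c : PowerSeries ℚ,
    (PowerSeries.X * (1 + PowerSeries.X * PowerSeries.C Polynomial.X * gesselX) ^ 3 -
      PowerSeries.map Polynomial.C a * PowerSeries.C Polynomial.X *
        (1 + PowerSeries.X * PowerSeries.C Polynomial.X * gesselX) ^ 2 +
      (PowerSeries.X * PowerSeries.map Polynomial.C b * PowerSeries.C Polynomial.X ^ 2 -
        PowerSeries.X * (PowerSeries.C Polynomial.X ^ 2 + 1) ^ 2 +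
        PowerSeries.C Polynomial.X * (PowerSeries.C Polynomial.X ^ 2 + 1)) *
        (1 + PowerSeries.X * PowerSeries.C Polynomial.X * gesselX) =
      PowerSeries.C Polynomial.X ^ 3 * PowerSeries.map Polynomial.C c) ∧
    ∀ y B : PowerSeries (Polynomial ℚ), y = PowerSeries.C Polynomial.X →
      B = y - PowerSeries.X ^ 2 * (1 + y) ^ 2 * gesselY +
        PowerSeries.X ^ 2 * (1 + y) * PowerSeries.map Polynomial.C gesselO →
      y * B ^ 3 - PowerSeries.map Polynomial.C a * (1 + y) * y * B ^ 2 +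
      (PowerSeries.X ^ 2 * (1 + y) ^ 2 * y * PowerSeries.map Polynomial.C b + y ^ 2 +
        PowerSeries.X ^ 2 * (1 + y) ^ 4 - 4 * PowerSeries.X ^ 2 * (1 + y) ^ 2 * y) * B =
      (1 + y) ^ 3 * y * (PowerSeries.X ^ 2 * PowerSeries.map Polynomial.C c) := by
  obtain ⟨F₁, hF₁⟩ := PowerSeries.exists_eq_eval_add gesselX 0
  obtain ⟨F₂, hF₂⟩ := PowerSeries.exists_eq_eval_add F₁ 0
  obtain ⟨Gy, hGy⟩ := PowerSeries.exists_eq_eval_add gesselY 0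
  obtain ⟨G', hG'⟩ := PowerSeries.exists_eq_eval_add gesselY (-1)
  rw [eval_gesselX, map_zero, sub_zero] at hF₁
  rw [eval_gesselY, map_zero, sub_zero] at hGy
  rw [map_zero, sub_zero] at hF₂
  rw [eval_neg_one_gesselY hF₁, map_neg, sub_neg_eq_add, map_one, map_add, map_one, map_add,
    map_one, map_mul, PowerSeries.map_X, add_comm (PowerSeries.C _)] at hG'
  set f₁ := PowerSeries.map (Polynomial.evalRingHom 0) F₁
  set O := PowerSeries.map Polynomial.C gesselO with hO
  set f₁' := PowerSeries.map Polynomial.C f₁ with hf₁'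
  have hX := pairedX_eq (t := PowerSeries.X) hF₁ hF₂
  have hY := pairedY_eq (t := PowerSeries.X) hGy hG'
  have hdvd := kernel_dvd (a := 1 + 2 * PowerSeries.X ^ 2 * ofConst gesselO)
    (b := -2 * PowerSeries.X * ofConst f₁ + ofConst gesselO +
      PowerSeries.X ^ 2 * ofConst gesselO ^ 2 + 2) functional_equation
  have hX' := congrArg (inVar 0) hX
  have hY' := congrArg (inVar 1) hY
  set HX := pairedX PowerSeries.X O f₁' (PowerSeries.C Polynomial.X) F₂ F₁ gesselX
  set HY := pairedY PowerSeries.X O f₁' (PowerSeries.C Polynomial.X) Gy G' gesselY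
  simp only [map_mul, map_sub, map_add, map_neg, map_one, map_pow, inVar_C, inVar_X, hO, hf₁',
    inVar_map_C, Polynomial.aeval_X, map_ofNat] at hX' hY'
  rw [← hX', ← hY'] at hdvd
  have hdvd2 : kernel (PowerSeries.C (X 0)) (PowerSeries.C (X 1)) PowerSeries.X ∣
      PowerSeries.X ^ 2 * inVar 0 HX - inVar 1 HY := by
    refine kernel_dvd_of_dvd_X (kernel_dvd_of_dvd_X (kernel_dvd_of_dvd_X (kernel_dvd_of_dvd_Y
      (kernel_dvd_of_dvd_one_add_Y (kernel_dvd_of_dvd_one_add_Y (kernel_dvd_of_dvd_one_add_Y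
        (hdvd.trans (dvd_of_eq ?_))))))))
    ring
  obtain ⟨R, hR⟩ := hdvd2
  have hR0 : R = 0 := by
    refine eq_zero_of_kernel_mul (f := PowerSeries.X ^ 2 * HX) (g := HY) ?_
    rw [map_mul, map_pow, inVar_X, hR]
  rw [hR0, mul_zero, sub_eq_zero] at hR
  obtain ⟨c, hcX, hcY⟩ := eq_const_of_inVar_eq hR
  refine ⟨1 + 2 * PowerSeries.X ^ 2 * gesselO, -2 * PowerSeries.X * f₁ + gesselO +
      PowerSeries.X ^ 2 * gesselO ^ 2 + 2, c, ?_, ?_⟩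
  · rw [← hcX, hX]
    simp [← hO, ← hf₁', map_ofNat (PowerSeries.map Polynomial.C)]
  · rintro y B rfl rfl
    rw [← hcY, hY]
    simp [← hO, ← hf₁', map_ofNat (PowerSeries.map Polynomial.C)]

/-- The coefficientwise derivative. -/
noncomputable def coeffDeriv :
    Derivation ℚ (PowerSeries (Polynomial ℚ)) (PowerSeries (Polynomial ℚ)) :=
  Derivation.mk'
    { toFun := fun f => PowerSeries.mk fun n => Polynomial.derivative (PowerSeries.coeff n f)
      map_add' := fun f g => by ext1 n; simp
      map_smul' := fun c f => by ext1 n; simp }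
    (fun f g => by
      ext1 n
      simp [PowerSeries.coeff_mul, Polynomial.derivative_mul,
        Finset.sum_add_distrib]
      rw [add_comm]
      congr 1
      rw [← Finset.Nat.sum_antidiagonal_swap]
      simp [mul_comm])

theorem coeff_coeffDeriv (n : ℕ) (f : PowerSeries (Polynomial ℚ)) :
    PowerSeries.coeff n (coeffDeriv f) = Polynomial.derivative (PowerSeries.coeff n f) :=
  PowerSeries.coeff_mk n fun n => Polynomial.derivative (PowerSeries.coeff n f)

theorem coeffDeriv_C (p : Polynomial ℚ) :
    coeffDeriv (PowerSeries.C p) = PowerSeries.C (Polynomial.derivative p) := by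
  ext1 n
  rw [coeff_coeffDeriv, PowerSeries.coeff_C, PowerSeries.coeff_C]
  split_ifs <;> simp

theorem coeffDeriv_map_C (f : PowerSeries ℚ) :
    coeffDeriv (PowerSeries.map Polynomial.C f) = 0 := by
  ext1 n
  simp [coeff_coeffDeriv]

theorem coeffDeriv_X : coeffDeriv PowerSeries.X = 0 := by
  simpa using coeffDeriv_map_C PowerSeries.X

theorem map_eval_map_C (f : PowerSeries ℚ) (c : ℚ) :
    PowerSeries.map (Polynomial.evalRingHom c) (PowerSeries.map Polynomial.C f) = f := by
  ext1 n
  simp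

/-- The vanishing of the derivative of the invariant at `±1` produces double roots. -/
theorem double_root_X {a b c : PowerSeries ℚ} {F : PowerSeries (Polynomial ℚ)}
    (h : PowerSeries.X * (1 + PowerSeries.X * PowerSeries.C Polynomial.X * F) ^ 3 -
      PowerSeries.map Polynomial.C a * PowerSeries.C Polynomial.X *
        (1 + PowerSeries.X * PowerSeries.C Polynomial.X * F) ^ 2 +
      (PowerSeries.X * PowerSeries.map Polynomial.C b * PowerSeries.C Polynomial.X ^ 2 -
        PowerSeries.X * (PowerSeries.C Polynomial.X ^ 2 + 1) ^ 2 +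
        PowerSeries.C Polynomial.X * (PowerSeries.C Polynomial.X ^ 2 + 1)) *
        (1 + PowerSeries.X * PowerSeries.C Polynomial.X * F) =
      PowerSeries.C Polynomial.X ^ 3 * PowerSeries.map Polynomial.C c) {s : ℚ} (hs : s ^ 2 = 1) :
    ∃ e : PowerSeries ℚ, PowerSeries.constantCoeff e = s ∧
      PowerSeries.X * e ^ 3 - a * e ^ 2 +
        (PowerSeries.X * b - 4 * PowerSeries.X + 2 * PowerSeries.C s) * e - c = 0 ∧
      3 * PowerSeries.X * e ^ 2 - 2 * a * e +
        (PowerSeries.X * b - 4 * PowerSeries.X + 2 * PowerSeries.C s) = 0 := by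
  have hd := congrArg (PowerSeries.map (Polynomial.evalRingHom s)) (congrArg coeffDeriv h)
  have h0 := congrArg (PowerSeries.map (Polynomial.evalRingHom s)) h
  simp only [map_add, map_sub, map_mul, map_pow, Derivation.leibniz, Derivation.leibniz_pow,
    coeffDeriv_C, coeffDeriv_X, coeffDeriv_map_C, smul_eq_mul, nsmul_eq_mul, map_one,
    PowerSeries.map_X, PowerSeries.map_C, Polynomial.derivative_X, map_eval_map_C,
    Derivation.map_one_eq_zero, Polynomial.coe_evalRingHom, Polynomial.eval_X, 
    map_zero, Nat.cast_ofNat, Nat.add_one_sub_one, pow_one,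
    map_ofNat] at hd h0
  set u := PowerSeries.map (Polynomial.evalRingHom s) F with hu
  set u' := PowerSeries.map (Polynomial.evalRingHom s) (coeffDeriv F) with hu'
  have he : PowerSeries.constantCoeff (PowerSeries.C s + PowerSeries.X * u) = s := by simp
  have hne : PowerSeries.X * u' - 1 ≠ 0 := fun h0 => by
    simpa using congrArg PowerSeries.constantCoeff h0
  set T : PowerSeries ℚ := PowerSeries.X
  refine ⟨PowerSeries.C s + T * u, he, ?_, mul_left_cancel₀ hne ?_⟩
  · obtain rfl | rfl := mul_self_eq_one_iff.mp ((sq s).symm.trans hs) <;> simp only [map_neg,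
      map_one] at h0 ⊢
    · linear_combination h0
    · linear_combination -h0
  · obtain rfl | rfl := mul_self_eq_one_iff.mp ((sq s).symm.trans hs) <;> simp only [map_neg,
      map_one] at h0 hd ⊢
    · linear_combination hd - 3 * h0
    · linear_combination -hd - 3 * h0

/-- The analogue of `double_root_X` for the invariant in `y`. -/
theorem double_root_Y {a b c o : PowerSeries ℚ} {G : PowerSeries (Polynomial ℚ)}
    (h : ∀ y B : PowerSeries (Polynomial ℚ), y = PowerSeries.C Polynomial.X →
      B = y - PowerSeries.X ^ 2 * (1 + y) ^ 2 * G +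
        PowerSeries.X ^ 2 * (1 + y) * PowerSeries.map Polynomial.C o →
      y * B ^ 3 - PowerSeries.map Polynomial.C a * (1 + y) * y * B ^ 2 +
      (PowerSeries.X ^ 2 * (1 + y) ^ 2 * y * PowerSeries.map Polynomial.C b + y ^ 2 +
        PowerSeries.X ^ 2 * (1 + y) ^ 4 - 4 * PowerSeries.X ^ 2 * (1 + y) ^ 2 * y) * B =
      (1 + y) ^ 3 * y * (PowerSeries.X ^ 2 * PowerSeries.map Polynomial.C c)) :
    ∃ β : PowerSeries ℚ, PowerSeries.constantCoeff β = 1 ∧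
      β ^ 3 - 2 * a * β ^ 2 + (4 * PowerSeries.X ^ 2 * b + 1) * β - 8 * PowerSeries.X ^ 2 * c = 0 ∧
      3 * β ^ 2 - 4 * a * β + (4 * PowerSeries.X ^ 2 * b + 1) = 0 := by
  obtain ⟨y, hy⟩ : ∃ y : PowerSeries (Polynomial ℚ), y = PowerSeries.C Polynomial.X := ⟨_, rfl⟩
  obtain ⟨B, hB⟩ : ∃ B, B = y - PowerSeries.X ^ 2 * (1 + y) ^ 2 * G +
        PowerSeries.X ^ 2 * (1 + y) * PowerSeries.map Polynomial.C o := ⟨_, rfl⟩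
  have h := h y B hy hB
  have hd := congrArg (PowerSeries.map (Polynomial.evalRingHom 1)) (congrArg coeffDeriv h)
  have h0 := congrArg (PowerSeries.map (Polynomial.evalRingHom 1)) h
  have hdB := congrArg (PowerSeries.map (Polynomial.evalRingHom 1)) (congrArg coeffDeriv hB)
  have hB0 := congrArg (PowerSeries.map (Polynomial.evalRingHom 1)) hB
  have hy0 : PowerSeries.map (Polynomial.evalRingHom 1) y = 1 := by simp [hy]
  have hyd : coeffDeriv y = 1 := by simp [hy, coeffDeriv_C]
  have h4 : coeffDeriv 4 = 0 := coeffDeriv.map_natCast 4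
  simp only [map_add, map_sub, map_mul, map_pow, Derivation.leibniz, Derivation.leibniz_pow,
    coeffDeriv_X, coeffDeriv_map_C, smul_eq_mul, nsmul_eq_mul, map_one, hy0, hyd, h4,
    PowerSeries.map_X, map_eval_map_C, Derivation.map_one_eq_zero,
    map_zero, Nat.cast_ofNat, Nat.add_one_sub_one, pow_one,
    map_ofNat] at hd h0 hdB hB0
  set β := PowerSeries.map (Polynomial.evalRingHom 1) B
  set β' := PowerSeries.map (Polynomial.evalRingHom 1) (coeffDeriv B)
  have hβ : PowerSeries.constantCoeff β = 1 := by simp [hB0]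
  have hβ' : PowerSeries.constantCoeff β' = 1 := by simp [hdB]
  have hne : 2 * β' - β ≠ 0 := fun h0 => by
    have := congrArg PowerSeries.constantCoeff h0
    rw [map_sub, map_mul, hβ, hβ', map_ofNat, map_zero] at this
    norm_num at this
  refine ⟨β, hβ, ?_, mul_left_cancel₀ hne ?_⟩
  · linear_combination h0
  · linear_combination 2 * hd - 5 * h0

/-- The coefficients of a cubic family with three prescribed double roots. -/
theorem exists_eta {A : Type*} [Field A] [CharZero A] {t a b c e₁ e₂ β : A} (ht : t ≠ 0)
    (h₁ : t * e₁ ^ 3 - a * e₁ ^ 2 + (t * b - 4 * t + 2) * e₁ - c = 0)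
    (h₁' : 3 * t * e₁ ^ 2 - 2 * a * e₁ + (t * b - 4 * t + 2) = 0)
    (h₂ : t * e₂ ^ 3 - a * e₂ ^ 2 + (t * b - 4 * t - 2) * e₂ - c = 0)
    (h₂' : 3 * t * e₂ ^ 2 - 2 * a * e₂ + (t * b - 4 * t - 2) = 0)
    (h₃ : β ^ 3 - 2 * a * β ^ 2 + (4 * t ^ 2 * b + 1) * β - 8 * t ^ 2 * c = 0)
    (h₃' : 3 * β ^ 2 - 4 * a * β + (4 * t ^ 2 * b + 1) = 0)
    (h12 : e₁ ≠ e₂) (h13 : 2 * t * e₁ ≠ β) (h23 : 2 * t * e₂ ≠ β) :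
    ∃ η, etaRel t η = 0 ∧ a = t * coeffA t η ∧ b = coeffB t η ∧ c = -t * coeffC t η := by
  obtain ⟨e₃, rfl⟩ : ∃ e₃, β = 2 * t * e₃ := ⟨β / (2 * t), by field_simp⟩
  have h2t : 2 * t ≠ 0 := mul_ne_zero two_ne_zero ht
  replace h13 : e₁ ≠ e₃ := fun h => h13 (by rw [h])
  replace h23 : e₂ ≠ e₃ := fun h => h23 (by rw [h])
  have q1 : 2 * t * e₁ ^ 3 - a * e₁ ^ 2 + c = 0 := by linear_combination e₁ * h₁' - h₁
  have q2 : 2 * t * e₂ ^ 3 - a * e₂ ^ 2 + c = 0 := by linear_combination e₂ * h₂' - h₂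
  have q3 : 2 * t * e₃ ^ 3 - a * e₃ ^ 2 + c = 0 := by
    refine mul_left_cancel₀ (mul_ne_zero two_ne_zero (pow_ne_zero 2 h2t)) ?_
    linear_combination (2 * t * e₃) * h₃' - h₃
  have v12 : 2 * t * (e₁ ^ 2 + e₁ * e₂ + e₂ ^ 2) = a * (e₁ + e₂) := by
    refine mul_left_cancel₀ (sub_ne_zero.mpr h12) ?_
    linear_combination q1 - q2
  have v13 : 2 * t * (e₁ ^ 2 + e₁ * e₃ + e₃ ^ 2) = a * (e₁ + e₃) := by
    refine mul_left_cancel₀ (sub_ne_zero.mpr h13) ?_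
    linear_combination q1 - q3
  obtain rfl : a = 2 * t * (e₁ + e₂ + e₃) := by
    refine mul_left_cancel₀ (sub_ne_zero.mpr h23) ?_
    linear_combination v13 - v12
  obtain ⟨m, η, rfl, rfl⟩ : ∃ m η, e₁ = m + η ∧ e₂ = m - η :=
    ⟨(e₁ + e₂) / 2, (e₁ - e₂) / 2, by ring, by ring⟩
  have hq : 2 * m * e₃ = η ^ 2 - m ^ 2 := by
    refine mul_left_cancel₀ h2t ?_
    linear_combination -v12
  have hη : t * η * (m + 2 * e₃) = 1 := by
    refine mul_left_cancel₀ (show (4 : A) ≠ 0 by norm_num) ?_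
    linear_combination (-1 : A) * h₁' + h₂'
  have hη0 : η ≠ 0 := by
    rintro rfl
    simp at hη
  obtain rfl : m = t * η ^ 3 := by linear_combination (-m) * hη + t * η * hq
  have he₃ : e₃ = (1 - t ^ 2 * η ^ 4) / (2 * t * η) := by
    rw [eq_div_iff (mul_ne_zero h2t hη0)]
    linear_combination hη
  have hb : b = coeffB t η := by
    unfold coeffB
    refine mul_left_cancel₀ h2t ?_
    linear_combination h₁' + h₂' + 4 * t * hq
  refine ⟨η, ?_, ?_, hb, ?_⟩
  · subst hb
    rw [he₃] at h₃'
    unfold coeffB at h₃'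
    unfold etaRel
    field_simp at h₃'
    linear_combination h₃'
  · rw [he₃]
    unfold coeffA
    field_simp
    ring
  · obtain rfl : c = -(2 * t * (t * η ^ 3 + η) ^ 3 -
      2 * t * (t * η ^ 3 + η + (t * η ^ 3 - η) + e₃) *
      (t * η ^ 3 + η) ^ 2) := by linear_combination q1
    rw [he₃]
    unfold coeffC
    field_simp
    ring

theorem ofConst_X : ofConst PowerSeries.X = PowerSeries.X := PowerSeries.map_X _

theorem ofConst_injective : Function.Injective ofConst := by
  intro f g h
  ext n
  simpa [ofConst] using congrArg (PowerSeries.coeff n) h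

/-- A parametrization of the cubics satisfied by the two invariants of the functional equation. -/
theorem exists_invCubic_eq_zero {Ω : Type*} [Field Ω]
    (j : PowerSeries (MvPolynomial (Fin 2) ℚ) →+* Ω) (hj : Function.Injective j) {x y t l α : Ω}
    (hx : j (PowerSeries.C (X 0)) = x) (hy : j (PowerSeries.C (X 1)) = y)
    (ht : j PowerSeries.X = t) (hl : x * l = 1 + t * x * j (inVar 0 gesselX))
    (hα : t * (1 + y) * α = y - t ^ 2 * (1 + y) ^ 2 * j (inVar 1 gesselY) +
      t ^ 2 * (1 + y) * j (ofConst gesselO)) (hx0 : x ≠ 0) (hy0 : y ≠ 0) (hv0 : 1 + y ≠ 0)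
    (ht0 : t ≠ 0) :
    ∃ η, etaRel t η = 0 ∧ invCubic t η (invX t x) l = 0 ∧ invCubic t η (invY t y) α = 0 := by
  obtain ⟨a, b, c, hX, hY⟩ := exists_cubic_equations
  obtain ⟨e₁, he₁, h₁, h₁'⟩ := double_root_X hX (s := 1) (by norm_num)
  obtain ⟨e₂, he₂, h₂, h₂'⟩ := double_root_X hX (s := -1) (by norm_num)
  obtain ⟨β, hβ, h₃, h₃'⟩ := double_root_Y hY
  have hY := hY _ _ rfl rfl
  let i : PowerSeries ℚ →+* Ω := j.comp ofConst
  have hi : Function.Injective i := hj.comp ofConst_injective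
  have hit : i PowerSeries.X = t := by rw [← ht, ← ofConst_X]; rfl
  have : CharZero Ω :=
    charZero_of_injective_ringHom (i.comp (PowerSeries.C : ℚ →+* PowerSeries ℚ)).injective
  obtain ⟨η, hη, ha, hb, hc⟩ := exists_eta (a := i a) (b := i b) (c := i c) (e₁ := i e₁)
    (e₂ := i e₂) (β := i β) ht0
    (by simpa [hit, map_ofNat i] using congrArg i h₁)
    (by simpa [hit, map_ofNat i] using congrArg i h₁')
    (by simpa [hit, map_ofNat i, ← sub_eq_add_neg] using congrArg i h₂)
    (by simpa [hit, map_ofNat i, ← sub_eq_add_neg] using congrArg i h₂')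
    (by simpa [hit, map_ofNat i] using congrArg i h₃)
    (by simpa [hit, map_ofNat i] using congrArg i h₃')
    (fun h => by
      have := congrArg PowerSeries.constantCoeff (hi h)
      rw [he₁, he₂] at this
      norm_num at this)
    (fun h => by
      rw [← hit, ← map_ofNat i, ← map_mul, ← map_mul] at h
      have := congrArg PowerSeries.constantCoeff (hi h)
      simp [hβ] at this)
    (fun h => by
      rw [← hit, ← map_ofNat i, ← map_mul, ← map_mul] at h
      have := congrArg PowerSeries.constantCoeff (hi h)
      simp [hβ] at this)
  have hX' := congrArg j (congrArg (inVar 0) hX)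
  have hY' := congrArg j (congrArg (inVar 1) hY)
  simp only [map_mul, map_sub, map_add, map_one, map_pow, inVar_C, inVar_X,
    inVar_map_C, Polynomial.aeval_X, map_ofNat, hx, hy, ht, ← hl, ← hα] at hX' hY'
  rw [show j (ofConst a) = t * coeffA t η from ha, show j (ofConst b) = coeffB t η from hb,
    show j (ofConst c) = -t * coeffC t η from hc] at hX' hY'
  refine ⟨η, hη, ?_, ?_⟩
  · refine mul_left_cancel₀ (mul_ne_zero ht0 (pow_ne_zero 3 hx0)) ?_
    have hI : t * x ^ 2 * invX t x = t * (x ^ 2 + 1) ^ 2 - x * (x ^ 2 + 1) := by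
      unfold invX
      field_simp
    unfold invCubic
    linear_combination hX' - x * l * hI
  · refine mul_left_cancel₀ (mul_ne_zero (pow_ne_zero 3 ht0)
      (mul_ne_zero hy0 (pow_ne_zero 3 hv0))) ?_
    have hI : t ^ 2 * (y * (1 + y) ^ 2) * invY t y =
        4 * t ^ 2 * y * (1 + y) ^ 2 - y ^ 2 - t ^ 2 * (1 + y) ^ 4 := by
      unfold invY
      field_simp
    unfold invCubic
    linear_combination hY' - t * (1 + y) * α * hI

theorem toPS_injective : Function.Injective toPS := Polynomial.coe_injective _

theorem toPS_C (p : MvPolynomial (Fin 2) ℚ) : toPS (Polynomial.C p) = PowerSeries.C p :=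
  Polynomial.coe_C p

theorem toPS_X : toPS Polynomial.X = PowerSeries.X := Polynomial.coe_X

theorem adjoin_simple_mul_add {k Ω : Type*} [Field k] [Field Ω] [Algebra k Ω] (z : Ω) {a : k}
    (ha : a ≠ 0) (b : k) :
    IntermediateField.adjoin k {algebraMap k Ω a * z + algebraMap k Ω b} =
      IntermediateField.adjoin k {z} := by
  apply le_antisymm <;> rw [IntermediateField.adjoin_simple_le_iff]
  · exact add_mem (mul_mem (IntermediateField.algebraMap_mem _ a)
      (IntermediateField.mem_adjoin_simple_self k z)) (IntermediateField.algebraMap_mem _ b)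
  · have h := IntermediateField.mem_adjoin_simple_self k
      (algebraMap k Ω a * z + algebraMap k Ω b)
    have ha' : algebraMap k Ω a ≠ 0 := (map_ne_zero _).mpr ha
    have hmem := mul_mem (inv_mem (IntermediateField.algebraMap_mem _ a))
      (sub_mem h (IntermediateField.algebraMap_mem _ b))
    rwa [add_sub_cancel_right, inv_mul_cancel_left₀ ha'] at hmem

theorem finrank_adjoin_Qfull {k Ω : Type*} [Field k] [Field Ω] [IsAlgClosed Ω] [Algebra k Ω]
    [Algebra (Polynomial (MvPolynomial (Fin 2) ℚ)) k]
    [IsFractionRing (Polynomial (MvPolynomial (Fin 2) ℚ)) k]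
    (j : PowerSeries (MvPolynomial (Fin 2) ℚ) →+* Ω) (hj : Function.Injective j)
    (hjk : ∀ r, algebraMap k Ω (algebraMap (Polynomial (MvPolynomial (Fin 2) ℚ)) k r) =
      j (toPS r)) :
    Module.finrank k (IntermediateField.adjoin k {j Qfull}) = 72 := by
  obtain ⟨x, hx⟩ : ∃ x : k, x = algebraMap (Polynomial (MvPolynomial (Fin 2) ℚ)) k
    (Polynomial.C (X 0)) := ⟨_, rfl⟩
  obtain ⟨y, hy⟩ : ∃ y : k, y = algebraMap (Polynomial (MvPolynomial (Fin 2) ℚ)) k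
    (Polynomial.C (X 1)) := ⟨_, rfl⟩
  obtain ⟨t, ht⟩ : ∃ t : k, t = algebraMap (Polynomial (MvPolynomial (Fin 2) ℚ)) k
    Polynomial.X := ⟨_, rfl⟩
  obtain ⟨x', hx'⟩ : ∃ x', x' = algebraMap k Ω x := ⟨_, rfl⟩
  obtain ⟨y', hy'⟩ : ∃ y', y' = algebraMap k Ω y := ⟨_, rfl⟩
  obtain ⟨t', ht'⟩ : ∃ t', t' = algebraMap k Ω t := ⟨_, rfl⟩
  have hjx : j (PowerSeries.C (X 0)) = x' := by rw [hx', hx, hjk, toPS_C]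
  have hjy : j (PowerSeries.C (X 1)) = y' := by rw [hy', hy, hjk, toPS_C]
  have hjt : j PowerSeries.X = t' := by rw [ht', ht, hjk, toPS_X]
  have hx0 : x' ≠ 0 := by
    rw [← hjx]
    exact (map_ne_zero_iff j hj).mpr ((map_ne_zero_iff _ PowerSeries.C_injective).mpr (X_ne_zero 0))
  have hy0 : y' ≠ 0 := by
    rw [← hjy]
    exact (map_ne_zero_iff j hj).mpr ((map_ne_zero_iff _ PowerSeries.C_injective).mpr (X_ne_zero 1))
  have ht0 : t' ≠ 0 := by
    rw [← hjt]
    exact (map_ne_zero_iff j hj).mpr PowerSeries.X_ne_zero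
  have hv0 : 1 + y' ≠ 0 := by
    rw [← hjy, ← map_one j, ← map_add]
    refine (map_ne_zero_iff j hj).mpr fun h => ?_
    have h1 := congrArg (fun f => aeval ![(0 : ℚ), 0] (PowerSeries.constantCoeff f)) h
    simp at h1
  have hK0 : kernel x y t ≠ 0 := by
    refine (map_ne_zero (algebraMap k Ω)).mp ?_
    have h1 : algebraMap k Ω (kernel x y t) =
        j (kernel (PowerSeries.C (X 0)) (PowerSeries.C (X 1)) PowerSeries.X) := by
      simp [kernel, ← hx', ← hy', ← ht', hjx, hjy, hjt]
    rw [h1]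
    refine (map_ne_zero_iff j hj).mpr fun h => ?_
    have h2 := congrArg PowerSeries.constantCoeff h
    simp [kernel] at h2
  have hfe := congrArg j functional_equation
  simp only [kernel, map_mul, map_sub, map_add, map_one, map_pow, hjx, hjy, hjt] at hfe
  obtain ⟨l, hl⟩ : ∃ l, x' * l = 1 + t' * x' * j (inVar 0 gesselX) :=
    ⟨(1 + t' * x' * j (inVar 0 gesselX)) / x', mul_div_cancel₀ _ hx0⟩
  obtain ⟨α, hα⟩ : ∃ α, t' * (1 + y') * α = y' - t' ^ 2 * (1 + y') ^ 2 * j (inVar 1 gesselY) +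
      t' ^ 2 * (1 + y') * j (ofConst gesselO) := ⟨_, mul_div_cancel₀ _ (mul_ne_zero ht0 hv0)⟩
  obtain ⟨η, hη, hlη, hαη⟩ := exists_invCubic_eq_zero j hj hjx hjy hjt hl hα hx0 hy0 hv0 ht0
  have hsub : α - l = algebraMap k Ω (kernel x y t) * j Qfull +
      algebraMap k Ω (kernel x y t / (t * x * (1 + y))) := by
    simp only [kernel, map_div₀, map_mul, map_sub, map_add, map_one, map_pow, ← hx', ← hy', ← ht']
    field_simp
    linear_combination x' * hα - t' * (1 + y') * hl - t' * x' * (1 + y') * hfe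
  rw [← adjoin_simple_mul_add (j Qfull) hK0 (kernel x y t / (t * x * (1 + y))), ← hsub]
  subst hx' hy' ht'
  exact finrank_adjoin_sub_eq_72 hx.symm hy.symm ht.symm hη hlη hαη

/-- `Q(x,y;t)` is algebraic over `ℚ(x,y,t)`, of degree exactly `72`: it is annihilated by
a nonzero polynomial of degree `72` in `z` with coefficients in `ℚ[x,y][t]`, and by no
nonzero polynomial of smaller degree in `z`. -/
theorem gessel_Q_algebraic_degree_72 :
    (∃ P : Polynomial (Polynomial (MvPolynomial (Fin 2) ℚ)), P ≠ 0 ∧ P.degree = 72 ∧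
        Polynomial.eval₂ toPS Qfull P = 0) ∧
    (∀ P : Polynomial (Polynomial (MvPolynomial (Fin 2) ℚ)), P ≠ 0 → P.degree < 72 →
        Polynomial.eval₂ toPS Qfull P ≠ 0) := by
  let R := Polynomial (MvPolynomial (Fin 2) ℚ)
  let k := FractionRing R
  let D := PowerSeries (MvPolynomial (Fin 2) ℚ)
  let Ω := AlgebraicClosure (FractionRing D)
  let j : D →+* Ω := (algebraMap (FractionRing D) Ω).comp (algebraMap D (FractionRing D))
  have hj : Function.Injective j :=
    (algebraMap (FractionRing D) Ω).injective.comp (IsFractionRing.injective D (FractionRing D))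
  have hjR : Function.Injective (j.comp toPS) := hj.comp toPS_injective
  let _ : Algebra k Ω := (IsFractionRing.lift (A := R) (K := k) hjR).toAlgebra
  have hjk : ∀ r : R, algebraMap k Ω (algebraMap R k r) = j (toPS r) := fun r =>
    IsFractionRing.lift_algebraMap hjR r
  have hrank := finrank_adjoin_Qfull j hj hjk
  have heval : ∀ P : Polynomial R, Polynomial.aeval (j Qfull) (P.map (algebraMap R k)) =
      j (Polynomial.eval₂ toPS Qfull P) := by
    intro P
    rw [Polynomial.aeval_def, Polynomial.eval₂_map, Polynomial.hom_eval₂,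
      show (algebraMap k Ω).comp (algebraMap R k) = j.comp toPS from RingHom.ext hjk]
  have hintegral : IsIntegral k (j Qfull) := by
    have : FiniteDimensional k (IntermediateField.adjoin k {j Qfull}) :=
      Module.finite_of_finrank_pos (by rw [hrank]; norm_num)
    exact (IntermediateField.AdjoinSimple.isIntegral_gen k (j Qfull)).mp (IsIntegral.of_finite k _)
  have hdeg : (minpoly k (j Qfull)).natDegree = 72 := by
    rw [← IntermediateField.adjoin.finrank hintegral, hrank]
  have hinjR : Function.Injective (algebraMap R k) := IsFractionRing.injective R k
  constructor
  · obtain ⟨b, hb, hP⟩ := IsLocalization.integerNormalization_spec (nonZeroDivisors R)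
      (minpoly k (j Qfull))
    set P := IsLocalization.integerNormalization (nonZeroDivisors R) (minpoly k (j Qfull))
    have hb0 : algebraMap R k b ≠ 0 :=
      (map_ne_zero_iff _ hinjR).mpr (nonZeroDivisors.ne_zero hb)
    have hP' : P.map (algebraMap R k) =
        Polynomial.C (algebraMap R k b) * minpoly k (j Qfull) := by
      rw [hP]
      ext n
      simp [Algebra.smul_def]
    have hPdeg : P.degree = 72 := by
      rw [← Polynomial.degree_map_eq_of_injective hinjR, hP', Polynomial.degree_C_mul hb0,
        Polynomial.degree_eq_natDegree (minpoly.ne_zero hintegral), hdeg]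
      rfl
    refine ⟨P, ?_, hPdeg, hj ?_⟩
    · rintro hP0
      simp [hP0] at hPdeg
    · rw [← heval, hP', map_mul, minpoly.aeval, mul_zero, map_zero]
  · intro P hP hdegP h0
    have h1 : minpoly k (j Qfull) ∣ P.map (algebraMap R k) := by
      refine minpoly.dvd k _ ?_
      rw [heval, h0, map_zero]
    have h2 := Polynomial.degree_le_of_dvd h1 ((Polynomial.map_ne_zero_iff hinjR).mpr hP)
    rw [Polynomial.degree_map_eq_of_injective hinjR, Polynomial.degree_eq_natDegree
      (minpoly.ne_zero hintegral), hdeg] at h2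
    exact absurd h2 (not_le.mpr hdegP)
end

section
/- Fix a nonnegative integer λ. In ℚ[[t]], the following identity holds: t²·Q_λ(0,0;t)² + (2λt + 1)·Q_λ(0,0;t) = 2·A_λ + 1. -/
/-- Weighted number of `n`-step quadrant walks from the origin to `(i,j)` with steps
`(−1,0), (−1,−1), (1,−1), (1,0), (1,1), (0,−1)`, where each `(1,0)` step has weight `2`
and each `(0,−1)` step has weight `lam`. -/
def kyCount (lam : ℕ) : ℕ → ℕ → ℕ → ℕ
  | 0, i, j => if i = 0 ∧ j = 0 then 1 else 0
  | n+1, i, j =>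
      kyCount lam n (i+1) j +
      kyCount lam n (i+1) (j+1) +
      (if 1 ≤ i then kyCount lam n (i-1) (j+1) else 0) +
      2 * (if 1 ≤ i then kyCount lam n (i-1) j else 0) +
      (if 1 ≤ i ∧ 1 ≤ j then kyCount lam n (i-1) (j-1) else 0) +
      lam * kyCount lam n i (j+1)

/-- `Q_λ(0,0;t) ∈ ℚ[[t]]`. -/
noncomputable def Q00wq (lam : ℕ) : PowerSeries ℚ :=
  PowerSeries.mk fun n => (kyCount lam n 0 0 : ℚ)

/-- `A_λ = t(λ Q_λ(0,0;t) + Σ_n w(1,0;n) tⁿ)`, i.e. `R_λ′(0)`. -/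
noncomputable def Awq (lam : ℕ) : PowerSeries ℚ :=
  PowerSeries.X * ((lam : PowerSeries ℚ) * Q00wq lam
    + PowerSeries.mk fun n => (kyCount lam n 1 0 : ℚ))

open Polynomial in
/-- The generating polynomial `∑ w(i,j;n) xⁱ yʲ` of walks of length `n`; the inner variable is `x`,
the outer one `y`. -/
noncomputable def kyPoly (lam n : ℕ) : ℚ[X][X] :=
  ∑ j ∈ Finset.range (n + 1), ∑ i ∈ Finset.range (n + 1),
    monomial j (monomial i (kyCount lam n i j : ℚ))

theorem kyCount_eq_zero (lam : ℕ) {n i j : ℕ} (h : n < i ∨ n < j) : kyCount lam n i j = 0 := by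
  induction n generalizing i j with
  | zero => rw [kyCount, if_neg]; omega
  | succ n ih =>
    rw [kyCount, ih (by omega), ih (by omega), ih (i := i) (by omega)]
    have h₁ : (if 1 ≤ i then kyCount lam n (i - 1) (j + 1) else 0) = 0 := by
      split_ifs
      exacts [ih (by omega), rfl]
    have h₂ : (if 1 ≤ i then kyCount lam n (i - 1) j else 0) = 0 := by
      split_ifs
      exacts [ih (by omega), rfl]
    have h₃ : (if 1 ≤ i ∧ 1 ≤ j then kyCount lam n (i - 1) (j - 1) else 0) = 0 := by
      split_ifs
      exacts [ih (by omega), rfl]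
    rw [h₁, h₂, h₃]
    simp

theorem coeff_coeff_kyPoly (lam n i j : ℕ) :
    ((kyPoly lam n).coeff j).coeff i = kyCount lam n i j := by
  have h : ∀ b a, (((Polynomial.monomial b (Polynomial.monomial a (kyCount lam n a b : ℚ))).coeff
      j).coeff i) = if b = j then (if a = i then (kyCount lam n a b : ℚ) else 0) else 0 := by
    intro b a
    rw [Polynomial.coeff_monomial]
    split_ifs with h₁ h₂ <;> simp_all [Polynomial.coeff_monomial]
  simp only [kyPoly, Polynomial.finsetSum_coeff, h]
  by_cases hj : j < n + 1
  · rw [Finset.sum_eq_single_of_mem j (Finset.mem_range.2 hj) (by intro b _ hb; simp [hb])]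
    by_cases hi : i < n + 1
    · rw [Finset.sum_eq_single_of_mem i (Finset.mem_range.2 hi) (by intro b _ hb; simp [hb])]
      simp
    · rw [kyCount_eq_zero lam (by omega)]
      exact (Finset.sum_eq_zero fun a ha => by
        have := Finset.mem_range.1 ha
        rw [if_pos rfl, if_neg (by omega)]).trans (by simp)
  · rw [kyCount_eq_zero lam (by omega)]
    exact (Finset.sum_eq_zero fun b hb => Finset.sum_eq_zero fun a _ => by
      have := Finset.mem_range.1 hb
      rw [if_neg (by omega)]).trans (by simp)

open Polynomial in
/-- The substitution `y = 0` on `ℚ[x][y]`. -/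
noncomputable def setYZero : ℚ[X][X] →+* ℚ[X][X] := C.comp constantCoeff

open Polynomial in
/-- The substitution `x = 0` on `ℚ[x][y]`. -/
noncomputable def setXZero : ℚ[X][X] →+* ℚ[X][X] := mapRingHom (C.comp constantCoeff)

theorem kyPoly_zero (lam : ℕ) : kyPoly lam 0 = 1 := by
  simp [kyPoly, kyCount]

open Polynomial in
/-- The step-by-step construction of quadrant walks. -/
theorem kyPoly_succ (lam n : ℕ) :
    C X * X * kyPoly lam (n + 1) =
      ((1 + X) + (lam : ℚ[X][X]) * C X + C X ^ 2 * (1 + X) ^ 2) * kyPoly lam n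
      - (1 + (lam : ℚ[X][X]) * C X + C X ^ 2) * setYZero (kyPoly lam n)
      - (1 + X) * setXZero (kyPoly lam n) + setXZero (setYZero (kyPoly lam n)) := by
  have e : ∀ p q r s : ℚ[X][X], ((1 + X) + (lam : ℚ[X][X]) * C X + C X ^ 2 * (1 + X) ^ 2) * p
      - (1 + (lam : ℚ[X][X]) * C X + C X ^ 2) * q - (1 + X) * r + s =
      p + X * p + C (C (lam : ℚ)) * (C X * p) + C X * (C X * p) + C (C 2) * (X * (C X * (C X * p)))
       + X * (X * (C X * (C X * p))) - q - C (C (lam : ℚ)) * (C X * q) - C X * (C X * q)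
       - r - X * r + s := by
    intro p q r s
    have h₁ : (C (C (lam : ℚ)) : ℚ[X][X]) = lam := by simp
    have h₂ : (C (C (2 : ℚ)) : ℚ[X][X]) = 2 := rfl
    rw [h₁, h₂]; ring
  rw [e, mul_assoc]
  ext j i
  rcases j with _ | _ | j <;> rcases i with _ | _ | i <;>
    simp [coeff_coeff_kyPoly, setXZero, setYZero, coeff_X_mul, kyCount, coeff_C] <;> ring

section Invariants

variable {B : Type*} [CommRing B] [IsDomain B]

open PowerSeries in
/-- A form of Tutte's invariant lemma: `f` and `g` play the roles of the substitutions
`y = 0` and `x = 0`. -/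
theorem eq_zero_of_invariant (f g : B →+* B) (hfg : ∀ b, f (g b) = g (f b)) {x y : B}
    (hfx : f x = x) (hfy : f y = 0) (hgy : g y = y) (hx : x ≠ 0) (hy : y ≠ 0)
    (P : B) {W V E : B⟦X⟧}
    (hW : map f W = W) (hV : map g V = V) (hE : map g E = 0)
    (h : C (1 + y) * W - C x * V = (C (x * y) - X * C P) * E) : E = 0 := by
  ext n
  induction n using Nat.strong_induction_on with
  | _ n ih =>
    have hPE : coeff n (X * (C P * E)) = 0 := by
      rcases n with _ | n
      · simp
      · rw [coeff_succ_X_mul, coeff_C_mul, ih n (Nat.lt_succ_self n)]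
        simp
    have h₀ := congrArg (coeff n) h
    rw [sub_mul, mul_assoc X] at h₀
    simp only [map_sub, coeff_C_mul, hPE, sub_zero] at h₀
    have hW' : f (coeff n W) = coeff n W := by simpa using congrArg (coeff n) hW
    have hV' : g (coeff n V) = coeff n V := by simpa using congrArg (coeff n) hV
    have hE' : g (coeff n E) = 0 := by simpa using congrArg (coeff n) hE
    have h₁ := congrArg f h₀
    simp only [map_sub, map_mul, map_add, map_one, hfx, hfy, hW', mul_zero, zero_mul, add_zero,
      one_mul] at h₁
    have h₂ : (1 + y) * f (coeff n V) - coeff n V = y * coeff n E :=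
      mul_left_cancel₀ hx (by linear_combination h₀ - (1 + y) * h₁)
    have h₃ := congrArg g h₂
    simp only [map_sub, map_mul, map_add, map_one, hgy, hE', mul_zero, hV', ← hfg] at h₃
    rw [h₃] at h₂
    rcases mul_eq_zero.1 h₂.symm with h₄ | h₄
    · exact absurd h₄ hy
    · simpa using h₄

end Invariants

/-- Power series in `t` over `ℚ[x][y]`. -/
abbrev KySeries := PowerSeries (Polynomial (Polynomial ℚ))

open PowerSeries in
/-- The quadrant generating function, as a series in `t` over `ℚ[x][y]`. -/
noncomputable def kySeries (lam : ℕ) : KySeries :=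
  mk (kyPoly lam)

/-- The variable `x`, as a series in `t` over `ℚ[x][y]`. -/
noncomputable def kyX : KySeries :=
  PowerSeries.C (Polynomial.C Polynomial.X)

/-- The variable `y`, as a series in `t` over `ℚ[x][y]`. -/
noncomputable def kyY : KySeries :=
  PowerSeries.C Polynomial.X

theorem setYZero_setXZero (p : Polynomial (Polynomial ℚ)) :
    setYZero (setXZero p) = setXZero (setYZero p) := by
  simp [setYZero, setXZero]

theorem setYZero_setYZero (p : Polynomial (Polynomial ℚ)) :
    setYZero (setYZero p) = setYZero p := by
  simp [setYZero]

theorem setXZero_setXZero (p : Polynomial (Polynomial ℚ)) :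
    setXZero (setXZero p) = setXZero p := by
  ext
  simp [setXZero]

theorem map_map_comm (F : KySeries) :
    PowerSeries.map setYZero (PowerSeries.map setXZero F) =
      PowerSeries.map setXZero (PowerSeries.map setYZero F) := by
  ext1 n
  simp [setYZero_setXZero]

theorem map_setYZero_idem (F : KySeries) :
    PowerSeries.map setYZero (PowerSeries.map setYZero F) = PowerSeries.map setYZero F := by
  ext1 n
  simp [setYZero_setYZero]

theorem map_setXZero_idem (F : KySeries) :
    PowerSeries.map setXZero (PowerSeries.map setXZero F) = PowerSeries.map setXZero F := by
  ext1 n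
  simp [setXZero_setXZero]

@[simp] theorem map_setYZero_kyX : PowerSeries.map setYZero kyX = kyX := by
  simp [kyX, setYZero]

@[simp] theorem map_setYZero_kyY : PowerSeries.map setYZero kyY = 0 := by
  simp [kyY, setYZero]

@[simp] theorem map_setXZero_kyX : PowerSeries.map setXZero kyX = 0 := by
  simp [kyX, setXZero]

@[simp] theorem map_setXZero_kyY : PowerSeries.map setXZero kyY = kyY := by
  simp [kyY, setXZero]

theorem kyX_ne_zero : kyX ≠ 0 := by
  rw [kyX, Ne, map_eq_zero_iff _ PowerSeries.C_injective]
  simp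

open PowerSeries in
/-- The functional equation of the quadrant generating function. -/
theorem kySeries_kernel (lam : ℕ) :
    (kyX * kyY - X * ((1 + kyY) + (lam : KySeries) * kyX + kyX ^ 2 * (1 + kyY) ^ 2))
        * kySeries lam =
      kyX * kyY - X * ((1 + (lam : KySeries) * kyX + kyX ^ 2) * map setYZero (kySeries lam)
        - map setXZero (map setYZero (kySeries lam)))
      - X * ((1 + kyY) * map setXZero (kySeries lam)) := by
  have hP : (1 + kyY) + (lam : KySeries) * kyX + kyX ^ 2 * (1 + kyY) ^ 2 =
      C ((1 + Polynomial.X) + (lam : Polynomial (Polynomial ℚ)) * Polynomial.C Polynomial.X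
        + Polynomial.C Polynomial.X ^ 2 * (1 + Polynomial.X) ^ 2) := by
    simp [kyX, kyY]
  have hq : 1 + (lam : KySeries) * kyX + kyX ^ 2 =
      C (1 + (lam : Polynomial (Polynomial ℚ)) * Polynomial.C Polynomial.X
        + Polynomial.C Polynomial.X ^ 2) := by
    simp [kyX]
  have hu : 1 + kyY = C (1 + Polynomial.X) := by simp [kyY]
  have hxy : kyX * kyY = C (Polynomial.C Polynomial.X * Polynomial.X) := by simp [kyX, kyY]
  rw [hP, hq, hu, hxy, sub_mul, mul_assoc X]
  ext1 n
  rcases n with _ | n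
  · rw [map_sub, coeff_C_mul, map_sub, map_sub, coeff_zero_X_mul, coeff_zero_X_mul,
      coeff_zero_X_mul]
    simp [kySeries, kyPoly_zero]
  · rw [map_sub, coeff_C_mul, map_sub, map_sub, coeff_succ_X_mul, coeff_succ_X_mul,
      coeff_succ_X_mul, map_sub, coeff_C_mul, coeff_C_mul, coeff_C_mul, coeff_C]
    simp only [kySeries, coeff_mk, coeff_map, kyPoly_succ]
    rw [if_neg n.succ_ne_zero]
    ring

/-- The embedding of `ℚ` in `ℚ[x][y]`. -/
noncomputable def kyConst : ℚ →+* Polynomial (Polynomial ℚ) := Polynomial.C.comp Polynomial.C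

open PowerSeries in
theorem map_map_kySeries (lam : ℕ) :
    map setXZero (map setYZero (kySeries lam)) = map kyConst (Q00wq lam) := by
  ext1 n
  simp [kySeries, setXZero, setYZero, kyConst, Q00wq, coeff_coeff_kyPoly]

open PowerSeries in
/-- `Q(x,0) = Q(0,0) + x Q₁(x)`, where `Q₁(0)` is the coefficient of `x` in `Q(x,0)`. -/
theorem exists_map_setYZero_kySeries_eq (lam : ℕ) :
    ∃ Q₁ : KySeries,
      map setYZero (kySeries lam) = map kyConst (Q00wq lam) + kyX * Q₁ ∧
      map setXZero Q₁ = map kyConst (mk fun n => (kyCount lam n 1 0 : ℚ)) := by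
  refine ⟨mk fun n => Polynomial.C ((kyPoly lam n).coeff 0).divX, ?_, ?_⟩
  · ext1 n
    rw [map_add, kyX, coeff_C_mul]
    simp only [kySeries, setYZero, kyConst, Q00wq, coeff_map, coeff_mk, RingHom.comp_apply,
      ← Polynomial.C_mul, ← Polynomial.C_add, ← coeff_coeff_kyPoly,
      Polynomial.constantCoeff_apply]
    congr 1
    rw [add_comm, Polynomial.X_mul_divX_add]
  · ext1 n
    simp [setXZero, kyConst, coeff_coeff_kyPoly, Polynomial.coeff_divX]

open PowerSeries in
/-- The equation with one catalytic variable for `R(x)`, written as `R = x R₁`. -/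
theorem catalytic_equation (lam : ℕ) {Q₁ : KySeries}
    (hQ₁ : map setYZero (kySeries lam) = map kyConst (Q00wq lam) + kyX * Q₁)
    (hQ₁' : map setXZero Q₁ = map kyConst (mk fun n => (kyCount lam n 1 0 : ℚ)))
    {R : KySeries}
    (hR : R = X * ((1 + (lam : KySeries) * kyX + kyX ^ 2) * map setYZero (kySeries lam)
        - map kyConst (Q00wq lam))) :
    2 * X * R + X * kyX * (kyX + R) ^ 2 + X * (lam : KySeries) * kyX ^ 2 - kyX * R =
      kyX * (2 * X * map kyConst (Awq lam)) := by
  set Q := kySeries lam with hQ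
  set W := 2 * X * R + X * kyX * (kyX + R) ^ 2 + X * (lam : KySeries) * kyX ^ 2
    - kyX * R with hWdef
  set S := X * ((1 + kyY) * map setXZero Q) with hS
  have h00 : map setXZero (map setYZero Q) = map kyConst (Q00wq lam) := map_map_kySeries lam
  have hker := kySeries_kernel lam
  rw [← hQ, h00, ← hR, ← hS] at hker
  have hYR : map setYZero R = R := by
    rw [hR]
    simp only [map_mul, map_sub, map_add, map_pow, map_one, map_natCast, map_X, map_setYZero_kyX,
      map_setYZero_idem, ← h00, map_map_comm]
  have hXR : map setXZero R = 0 := by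
    rw [hR]
    simp only [map_mul, map_sub, map_add, map_pow, map_one, map_natCast, map_X, map_setXZero_kyX,
      map_setXZero_idem, ← h00]
    ring
  have hXS : map setXZero S = S := by
    rw [hS]
    simp only [map_mul, map_add, map_one, map_X, map_setXZero_kyY, map_setXZero_idem]
  have hYW : map setYZero W = W := by
    rw [hWdef]
    simp only [map_mul, map_sub, map_add, map_pow, map_natCast, map_ofNat, map_X,
      map_setYZero_kyX, hYR]
  set V := X * (1 + kyY) * S ^ 2 - (1 + kyY) * S + 2 * (1 + X * (lam : KySeries)) * S
    + X * (1 + kyY) * (kyY - 1) with hVdef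
  have hXV : map setXZero V = V := by
    rw [hVdef]
    simp only [map_mul, map_sub, map_add, map_pow, map_natCast, map_ofNat, map_X, map_one,
      map_setXZero_kyY, hXS]
  set E := -((1 + X * kyX * (1 + kyY) * Q) * (kyX + R - S)
    + Q * (X * (1 + kyY) - (1 + X * (lam : KySeries)) * kyX)) with hEdef
  have hXE : map setXZero E = 0 := by
    rw [hEdef]
    simp only [map_mul, map_sub, map_add, map_neg, map_natCast, map_X, map_one,
      map_setXZero_kyY, map_setXZero_kyX, hXS, hXR]
    rw [hS]
    ring
  have hfact : (1 + kyY) * W - kyX * V = (kyX * kyY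
      - X * ((1 + kyY) + (lam : KySeries) * kyX + kyX ^ 2 * (1 + kyY) ^ 2)) * E := by
    linear_combination (X * kyX * (1 + kyY) * (kyX + R - S) + X * (1 + kyY)
      - (1 + X * (lam : KySeries)) * kyX) * hker
  have hE : E = 0 := by
    refine eq_zero_of_invariant setYZero setXZero setYZero_setXZero (x := Polynomial.C Polynomial.X)
      (y := Polynomial.X) (by simp [setYZero]) (by simp [setYZero])
      (by simp [setXZero]) (by simp) (by simp)
      ((1 + Polynomial.X) + (lam : Polynomial (Polynomial ℚ)) * Polynomial.C Polynomial.X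
        + Polynomial.C Polynomial.X ^ 2 * (1 + Polynomial.X) ^ 2) hYW hXV hXE ?_
    simpa [kyX, kyY] using hfact
  rw [hE, mul_zero] at hfact
  have hWV : W = kyX * map setYZero V := by
    have := congrArg (map setYZero) hfact
    simp only [map_mul, map_sub, map_add, map_one, map_setYZero_kyX, map_setYZero_kyY, hYW,
      map_zero] at this
    linear_combination this
  have hR₁ : R = kyX * (X * (Q₁ + ((lam : KySeries) + kyX) * map setYZero Q)) := by
    rw [hR]
    linear_combination X * hQ₁
  set R₁ := X * (Q₁ + ((lam : KySeries) + kyX) * map setYZero Q) with hR₁def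
  have hW₁ : map setYZero V = 2 * X * R₁ + X * (kyX + R) ^ 2 + X * (lam : KySeries) * kyX - R :=
    mul_left_cancel₀ kyX_ne_zero (by
      rw [← hWV, hWdef]
      linear_combination 2 * X * hR₁)
  have hconst : map setYZero V = 2 * X * map setXZero R₁ := by
    have := congrArg (map setXZero) hW₁
    rw [← map_map_comm, hXV] at this
    rw [this]
    simp only [map_mul, map_sub, map_add, map_pow, map_natCast, map_ofNat, map_X,
      map_setXZero_kyX, hXR]
    ring
  have hA : map setXZero R₁ = map kyConst (Awq lam) := by
    rw [hR₁def, Awq]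
    simp only [map_mul, map_add, map_natCast, map_X, map_setXZero_kyX, h00, hQ₁']
    ring
  rw [hWV, hconst, hA]

theorem eq_zero_of_quadratic_dvd (b z : ℚ) {p : Polynomial ℚ}
    (h : (1 + Polynomial.C b * Polynomial.X + Polynomial.X ^ 2) * p =
      Polynomial.X * Polynomial.C z) : z = 0 := by
  have hq : (1 + Polynomial.C b * Polynomial.X + Polynomial.X ^ 2 : Polynomial ℚ).natDegree = 2 := by
    compute_degree!
  by_contra hz
  have hp : p ≠ 0 := by
    rintro rfl
    simp [hz] at h
  have hq₀ : (1 + Polynomial.C b * Polynomial.X + Polynomial.X ^ 2 : Polynomial ℚ) ≠ 0 := by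
    intro h₀
    simp [h₀] at hq
  have := congrArg Polynomial.natDegree h
  rw [Polynomial.natDegree_mul hq₀ hp, hq, Polynomial.natDegree_X_mul (by simpa using hz),
    Polynomial.natDegree_C] at this
  omega

open PowerSeries in
theorem eq_zero_of_kernel_dvd (lam : ℕ) {Z : PowerSeries ℚ}
    {G : KySeries}
    (h : (1 + (lam : KySeries) * kyX + kyX ^ 2) * G = kyX * map kyConst Z) : Z = 0 := by
  ext n
  have hq : 1 + (lam : KySeries) * kyX + kyX ^ 2 =
      C (Polynomial.C (1 + Polynomial.C (lam : ℚ) * Polynomial.X + Polynomial.X ^ 2)) := by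
    simp [kyX]
  rw [hq] at h
  have h₁ := congrArg (fun F => (coeff n F).coeff 0) h
  simp only [kyX, coeff_C_mul, Polynomial.coeff_C_mul, coeff_map, kyConst,
    RingHom.comp_apply, Polynomial.coeff_C_zero] at h₁
  simpa using eq_zero_of_quadratic_dvd _ _ h₁

/-- The quadratic equation for `Q_λ(0,0;t)`:
`t² Q_λ(0,0;t)² + (2λt+1) Q_λ(0,0;t) = 2 R_λ′(0) + 1`. -/
theorem ky_Q00_quadratic (lam : ℕ) :
    PowerSeries.X ^ 2 * Q00wq lam ^ 2
      + (2 * (lam : PowerSeries ℚ) * PowerSeries.X + 1) * Q00wq lam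
    = 2 * Awq lam + 1 := by
  obtain ⟨Q₁, hQ₁, hQ₁'⟩ := exists_map_setYZero_kySeries_eq lam
  have h := catalytic_equation lam hQ₁ hQ₁' rfl
  set q := PowerSeries.map setYZero (kySeries lam)
  set Q₀ := PowerSeries.map kyConst (Q00wq lam) with hQ₀
  refine sub_eq_zero.1 ((mul_eq_zero.1 (eq_zero_of_kernel_dvd lam (Z := PowerSeries.X *
    (PowerSeries.X ^ 2 * Q00wq lam ^ 2
      + (2 * (lam : PowerSeries ℚ) * PowerSeries.X + 1) * Q00wq lam - (2 * Awq lam + 1)))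
    (G := -((kyX * PowerSeries.X - 2 * PowerSeries.X ^ 2 * Q₀) + PowerSeries.X * q *
      (2 * PowerSeries.X + PowerSeries.X * kyX * (2 * (kyX - PowerSeries.X * Q₀)
        + (1 + (lam : KySeries) * kyX + kyX ^ 2)
          * (PowerSeries.X * q)) - kyX))) ?_)).resolve_left PowerSeries.X_ne_zero)
  simp only [map_mul, map_sub, map_add, map_pow, map_natCast, map_ofNat, map_one,
    PowerSeries.map_X, ← hQ₀]
  linear_combination -h
end
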